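/- arXiv:2211.10465 — 3 statements merged into one kernel-verified Lean document; each statement's English description precedes it below -/
import Mathlib

section
/- Let N ≥ 1, 0 < γ < μ < N, and q₁, q₂ ∈ (1,∞] satisfy 0 ≤ 1/q₂ < (μ−γ)/N + 1/q₁ < μ/N + 1/q₁ < 1. Then there exists a constant C > 0, depending only on N, γ, μ, q₁, q₂, such that for every t > 0 and every measurable u : ℝ^N → ℝ whose weighted function |·|^μ u lies in weak-L^{q₁}, one has ‖ |·|^γ (G_t ⋆ u) ‖_{q₂} ≤ C t^{−(N/2)(1/q₁ − 1/q₂) − (μ−γ)/2} ‖ |·|^μ u ‖_{L^{q₁,∞}}, where ‖f‖_{L^{q₁,∞}} := sup_{s>0} s · (Lebesgue measure of {x : |f(x)| > s})^{1/q₁} is the weak-L^{q₁} quasinorm (with the convention ‖f‖_{L^{∞,∞}} = ‖f‖_∞). -/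
open MeasureTheory Real Set ENNReal Filter

noncomputable section

abbrev ESp (N : ℕ) := EuclideanSpace ℝ (Fin N)

def heatKernel (N : ℕ) (t : ℝ) (x : ESp N) : ℝ :=
  (4 * π * t) ^ (-(N : ℝ) / 2) * Real.exp (-‖x‖ ^ 2 / (4 * t))

def heatConv (N : ℕ) (t : ℝ) (u : ESp N → ℝ) (x : ESp N) : ℝ :=
  ∫ y, heatKernel N t (x - y) * u y

/-- The weak-`L^q` quasinorm:  `sup_{s>0} s · (volume {|f| > s})^{1/q}`,
with the convention that for `q = ∞` it is the essential supremum norm. -/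
def weakNorm (N : ℕ) (q : ℝ≥0∞) (f : ESp N → ℝ) : ℝ≥0∞ :=
  if q = ∞ then eLpNorm f ∞ volume
  else ⨆ (s : ℝ) (_ : 0 < s),
    ENNReal.ofReal s * (volume {x : ESp N | s < |f x|}) ^ q.toReal⁻¹

/-- Truncated-above part of a function with a power-type distribution bound, `a > 1`. -/
lemma exists_lintegral_excess_le {α : Type*} [MeasurableSpace α] (ν : Measure α) {K a : ℝ}
    (ha : 1 < a) :
    ∃ C : ℝ≥0∞, C ≠ ∞ ∧ ∀ h : α → ℝ, Measurable h →
      (∀ s : ℝ, 0 < s → ν {x | s < h x} ≤ ENNReal.ofReal (K * s ^ (-a))) →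
      ∫⁻ x, ENNReal.ofReal (max (h x - 1) 0) ∂ν ≤ C := by
  refine ⟨∫⁻ t in Ioi (0 : ℝ), ENNReal.ofReal (K * (t + 1) ^ (-a)), ?_, fun h hm hd => ?_⟩
  · exact ((integrableOn_add_rpow_Ioi_of_lt (by linarith) (by norm_num)).const_mul
      K).lintegral_lt_top.ne
  · rw [lintegral_eq_lintegral_meas_lt (f := fun x => max (h x - 1) 0) ν
      (Eventually.of_forall fun x => le_max_right _ _) ((hm.sub_const 1).max measurable_const).aemeasurable]
    refine setLIntegral_mono' measurableSet_Ioi fun t ht => ?_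
    have ht : (0 : ℝ) < t := ht
    refine (measure_mono fun x hx => ?_).trans (hd (t + 1) (by linarith))
    rcases lt_max_iff.1 (show t < max (h x - 1) 0 from hx) with h1 | h1
    · show t + 1 < h x
      linarith
    · linarith

/-- Truncated-below part of a function with a power-type distribution bound, `q > a`. -/
lemma exists_lintegral_min_rpow_le {α : Type*} [MeasurableSpace α] (ν : Measure α) {K a q : ℝ}
    (hq : 0 < q) (haq : a < q) :
    ∃ C : ℝ≥0∞, C ≠ ∞ ∧ ∀ h : α → ℝ, Measurable h → (∀ x, 0 ≤ h x) →
      (∀ s : ℝ, 0 < s → ν {x | s < h x} ≤ ENNReal.ofReal (K * s ^ (-a))) →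
      ∫⁻ x, ENNReal.ofReal (min (h x) 1) ^ q ∂ν ≤ C := by
  refine ⟨ENNReal.ofReal q * ∫⁻ t in Ioc (0 : ℝ) 1, ENNReal.ofReal (K * t ^ (q - a - 1)), ?_,
    fun h hm h0 hd => ?_⟩
  · refine ENNReal.mul_ne_top ENNReal.ofReal_ne_top ?_
    have := (intervalIntegral.intervalIntegrable_rpow' (a := 0) (b := 1)
      (show -1 < q - a - 1 by linarith)).1
    exact (this.const_mul K).lintegral_lt_top.ne
  · have h0' : ∀ x, 0 ≤ min (h x) 1 := fun x => le_min (h0 x) zero_le_one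
    simp_rw [fun x => ENNReal.ofReal_rpow_of_nonneg (h0' x) hq.le]
    rw [lintegral_rpow_eq_lintegral_meas_lt_mul ν (Eventually.of_forall h0')
      (hm.min measurable_const).aemeasurable hq]
    refine mul_le_mul_right ?_ _
    rw [← lintegral_indicator measurableSet_Ioi, ← lintegral_indicator measurableSet_Ioc]
    refine lintegral_mono fun t => ?_
    by_cases ht : 0 < t
    swap
    · rw [indicator_of_notMem (by simpa using ht)]; exact zero_le
    rw [indicator_of_mem (show t ∈ Ioi 0 from ht)]
    by_cases ht1 : t ≤ 1
    · rw [indicator_of_mem (show t ∈ Ioc 0 1 from ⟨ht, ht1⟩)]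
      calc ν {x | t < min (h x) 1} * ENNReal.ofReal (t ^ (q - 1))
          ≤ ENNReal.ofReal (K * t ^ (-a)) * ENNReal.ofReal (t ^ (q - 1)) := by
            refine mul_le_mul_left (le_trans (measure_mono ?_) (hd t ht)) _
            exact fun x hx => (lt_min_iff.1 (show t < min (h x) 1 from hx)).1
        _ = ENNReal.ofReal (K * t ^ (q - a - 1)) := by
            rw [← ENNReal.ofReal_mul' (by positivity), mul_assoc, ← rpow_add ht]
            congr 3
            ring
    · have : {x | t < min (h x) 1} = ∅ := by
        ext x
        simp only [mem_ofPred_eq, lt_min_iff, mem_empty_iff_false, iff_false, not_and]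
        exact fun _ h2 => ht1 h2.le
      rw [this, measure_empty, zero_mul]
      exact zero_le

/-- `Lᵠ` bound for the convolution of a bounded integrable kernel with an integrable function. -/
lemma exists_eLpNorm_conv_le_of_lintegral {N : ℕ} {g : ESp N → ℝ≥0∞} (hg : Measurable g)
    (hg1 : ∀ x, g x ≤ 1) (hgi : ∫⁻ x, g x ≠ ∞) {q : ℝ≥0∞} (hq : 1 < q) {I : ℝ≥0∞} (hI : I ≠ ∞) :
    ∃ C : ℝ≥0∞, C ≠ ∞ ∧ ∀ w : ESp N → ℝ≥0∞, Measurable w → ∫⁻ y, w y ≤ I →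
      eLpNorm (fun x => ∫⁻ y, g (x - y) * w y) q volume ≤ C := by
  have key : ∀ w : ESp N → ℝ≥0∞, ∫⁻ y, w y ≤ I → ∀ x, ∫⁻ y, g (x - y) * w y ≤ I := by
    intro w hwI x
    refine le_trans (lintegral_mono fun y => ?_) hwI
    exact mul_le_of_le_one_left' (hg1 _)
  by_cases hqt : q = ∞
  · subst hqt
    refine ⟨I, hI, fun w _ hwI => ?_⟩
    rw [eLpNorm_exponent_top]
    exact eLpNormEssSup_le_of_ae_enorm_bound (Eventually.of_forall fun x => key w hwI x)
  have hq1 : 1 < q.toReal := by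
    rw [← ENNReal.toReal_one]; exact (ENNReal.toReal_lt_toReal (by simp) hqt).2 hq
  refine ⟨(I ^ (q.toReal - 1) * ((∫⁻ x, g x) * I)) ^ (1 / q.toReal), ?_, fun w hw hwI => ?_⟩
  · refine ENNReal.rpow_ne_top_of_nonneg (by positivity) (ENNReal.mul_ne_top ?_
      (ENNReal.mul_ne_top hgi hI))
    exact ENNReal.rpow_ne_top_of_nonneg (by linarith) hI
  · rw [eLpNorm_eq_lintegral_rpow_enorm_toReal (by positivity) hqt]
    refine ENNReal.rpow_le_rpow ?_ (by positivity)
    have hm : Measurable fun p : ESp N × ESp N => g (p.1 - p.2) * w p.2 := by fun_prop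
    calc ∫⁻ x, ‖∫⁻ y, g (x - y) * w y‖ₑ ^ q.toReal
        ≤ ∫⁻ x, I ^ (q.toReal - 1) * ∫⁻ y, g (x - y) * w y := by
          refine lintegral_mono fun x => ?_
          rw [enorm_eq_self]
          have e : q.toReal = (q.toReal - 1) + 1 := by ring
          conv_lhs => rw [e]
          rw [ENNReal.rpow_add_of_nonneg _ _ (by linarith) zero_le_one, ENNReal.rpow_one]
          gcongr
          exact key w hwI x
      _ = I ^ (q.toReal - 1) * ∫⁻ y, ∫⁻ x, g (x - y) * w y := by
          rw [lintegral_const_mul _ hm.lintegral_prod_right', lintegral_lintegral_swap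
            hm.aemeasurable]
      _ = I ^ (q.toReal - 1) * ((∫⁻ x, g x) * ∫⁻ y, w y) := by
          congr 1
          rw [← lintegral_const_mul _ hw]
          refine lintegral_congr fun y => ?_
          rw [lintegral_mul_const _ (by fun_prop), lintegral_sub_right_eq_self]
      _ ≤ _ := by gcongr

/-- `Lᵠ` bound for the convolution of an integrable kernel with a bounded `Lᵠ` function. -/
lemma exists_eLpNorm_conv_le_of_le_one {N : ℕ} {g : ESp N → ℝ≥0∞} (hg : Measurable g)
    (hgi : ∫⁻ x, g x ≠ ∞) {q : ℝ≥0∞} (hq : 1 < q) {J : ℝ≥0∞} (hJ : J ≠ ∞) :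
    ∃ C : ℝ≥0∞, C ≠ ∞ ∧ ∀ w : ESp N → ℝ≥0∞, Measurable w → (∀ y, w y ≤ 1) →
      (q ≠ ∞ → ∫⁻ y, w y ^ q.toReal ≤ J) →
      eLpNorm (fun x => ∫⁻ y, g (x - y) * w y) q volume ≤ C := by
  have hleft : ∀ x : ESp N, ∫⁻ y, g (x - y) = ∫⁻ y, g y := fun x =>
    lintegral_sub_left_eq_self g x
  by_cases hqt : q = ∞
  · subst hqt
    refine ⟨∫⁻ x, g x, hgi, fun w _ hw1 _ => ?_⟩
    rw [eLpNorm_exponent_top]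
    refine eLpNormEssSup_le_of_ae_enorm_bound (Eventually.of_forall fun x => ?_)
    rw [enorm_eq_self, ← hleft x]
    exact lintegral_mono fun y => mul_le_of_le_one_right' (hw1 _)
  have hq1 : 1 < q.toReal := by
    rw [← ENNReal.toReal_one]; exact (ENNReal.toReal_lt_toReal (by simp) hqt).2 hq
  have hq0 : 0 < q.toReal := by linarith
  have hq0' : q.toReal ≠ 0 := hq0.ne'
  set r := q.toReal with hr
  have hr1 : 0 ≤ 1 - r⁻¹ := by
    have := inv_lt_one_of_one_lt₀ hq1
    linarith
  refine ⟨((∫⁻ x, g x) ^ (r - 1) * ((∫⁻ x, g x) * J)) ^ (1 / r), ?_, fun w hw _ hwJ => ?_⟩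
  · refine ENNReal.rpow_ne_top_of_nonneg (by positivity) (ENNReal.mul_ne_top ?_
      (ENNReal.mul_ne_top hgi hJ))
    exact ENNReal.rpow_ne_top_of_nonneg (by linarith) hgi
  · rw [eLpNorm_eq_lintegral_rpow_enorm_toReal (by positivity) hqt]
    refine ENNReal.rpow_le_rpow ?_ (by positivity)
    have hm : Measurable fun p : ESp N × ESp N => g (p.1 - p.2) * w p.2 ^ r := by fun_prop
    calc ∫⁻ x, ‖∫⁻ y, g (x - y) * w y‖ₑ ^ r
        ≤ ∫⁻ x, (∫⁻ y, g y) ^ (r - 1) * ∫⁻ y, g (x - y) * w y ^ r := by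
          refine lintegral_mono fun x => ?_
          rw [enorm_eq_self]
          have holder := ENNReal.lintegral_mul_norm_pow_le (μ := (volume : Measure (ESp N)))
            (f := fun y => g (x - y) * w y ^ r) (g := fun y => g (x - y))
            (by fun_prop) (by fun_prop) (p := r⁻¹) (q := 1 - r⁻¹) (by positivity) hr1 (by ring)
          have e : ∀ y, (g (x - y) * w y ^ r) ^ r⁻¹ * g (x - y) ^ (1 - r⁻¹) =
              g (x - y) * w y := by
            intro y
            rw [ENNReal.mul_rpow_of_nonneg _ _ (by positivity), ← ENNReal.rpow_mul,
              mul_inv_cancel₀ hq0', ENNReal.rpow_one, mul_right_comm,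
              ← ENNReal.rpow_add_of_nonneg _ _ (by positivity) hr1]
            simp
          simp_rw [e] at holder
          rw [hleft] at holder
          refine (ENNReal.rpow_le_rpow holder hq0.le).trans_eq ?_
          rw [ENNReal.mul_rpow_of_nonneg _ _ hq0.le, ← ENNReal.rpow_mul, ← ENNReal.rpow_mul,
            inv_mul_cancel₀ hq0', ENNReal.rpow_one, mul_comm, sub_mul, inv_mul_cancel₀ hq0',
            one_mul]
      _ = (∫⁻ y, g y) ^ (r - 1) * ∫⁻ y, ∫⁻ x, g (x - y) * w y ^ r := by
          rw [lintegral_const_mul _ hm.lintegral_prod_right', lintegral_lintegral_swap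
            hm.aemeasurable]
      _ = (∫⁻ y, g y) ^ (r - 1) * ((∫⁻ x, g x) * ∫⁻ y, w y ^ r) := by
          congr 1
          rw [← lintegral_const_mul _ (by fun_prop)]
          refine lintegral_congr fun y => ?_
          rw [lintegral_mul_const _ (by fun_prop), lintegral_sub_right_eq_self]
      _ ≤ _ := by
          gcongr
          exact hwJ hqt

/-- Convolution with a bounded integrable kernel maps weak `Lᵃ` into `Lᵠ` when `1 < a < q`. -/
lemma exists_eLpNorm_conv_le {N : ℕ} {g : ESp N → ℝ≥0∞} (hg : Measurable g)
    (hg1 : ∀ x, g x ≤ 1) (hgi : ∫⁻ x, g x ≠ ∞) {q : ℝ≥0∞} (hq : 1 < q) {K a : ℝ} (ha : 1 < a)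
    (haq : q.toReal⁻¹ < a⁻¹) :
    ∃ C : ℝ≥0∞, C ≠ ∞ ∧ ∀ h : ESp N → ℝ, Measurable h → (∀ x, 0 ≤ h x) →
      (∀ s : ℝ, 0 < s → volume {x | s < h x} ≤ ENNReal.ofReal (K * s ^ (-a))) →
      eLpNorm (fun x => ∫⁻ y, g (x - y) * ENNReal.ofReal (h y)) q volume ≤ C := by
  obtain ⟨I, hI, hI'⟩ := exists_lintegral_excess_le (volume : Measure (ESp N)) (K := K) ha
  obtain ⟨J, hJ, hJ'⟩ : ∃ J : ℝ≥0∞, J ≠ ∞ ∧ ∀ h : ESp N → ℝ, Measurable h → (∀ x, 0 ≤ h x) →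
      (∀ s : ℝ, 0 < s → volume {x | s < h x} ≤ ENNReal.ofReal (K * s ^ (-a))) →
      q ≠ ∞ → ∫⁻ x, ENNReal.ofReal (min (h x) 1) ^ q.toReal ≤ J := by
    by_cases hqt : q = ∞
    · exact ⟨0, by simp, fun _ _ _ _ h => (h hqt).elim⟩
    have hq0 : 0 < q.toReal := ENNReal.toReal_pos (by positivity) hqt
    obtain ⟨J, hJ, hJ'⟩ := exists_lintegral_min_rpow_le (volume : Measure (ESp N)) (K := K)
      hq0 ((inv_lt_inv₀ hq0 (by linarith)).1 haq)
    exact ⟨J, hJ, fun h h1 h2 h3 _ => hJ' h h1 h2 h3⟩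
  obtain ⟨C₁, hC₁, hC₁'⟩ := exists_eLpNorm_conv_le_of_lintegral hg hg1 hgi hq hI
  obtain ⟨C₂, hC₂, hC₂'⟩ := exists_eLpNorm_conv_le_of_le_one hg hgi hq hJ
  refine ⟨C₁ + C₂, ENNReal.add_ne_top.2 ⟨hC₁, hC₂⟩, fun h hm h0 hd => ?_⟩
  have hm1 : Measurable fun x => ENNReal.ofReal (max (h x - 1) 0) := by fun_prop
  have hm2 : Measurable fun x => ENNReal.ofReal (min (h x) 1) := by fun_prop
  have split : (fun x => ∫⁻ y, g (x - y) * ENNReal.ofReal (h y)) =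
      (fun x => ∫⁻ y, g (x - y) * ENNReal.ofReal (max (h y - 1) 0)) +
      (fun x => ∫⁻ y, g (x - y) * ENNReal.ofReal (min (h y) 1)) := by
    ext x
    rw [Pi.add_apply, ← lintegral_add_left (by fun_prop)]
    refine lintegral_congr fun y => ?_
    rw [← mul_add, ← ENNReal.ofReal_add (le_max_right _ _) (le_min (h0 y) zero_le_one)]
    congr 2
    rcases le_total (h y) 1 with h1 | h1
    · rw [min_eq_left h1, max_eq_right (by linarith), zero_add]
    · rw [min_eq_right h1, max_eq_left (by linarith), sub_add_cancel]
  have hmT : ∀ w : ESp N → ℝ≥0∞, Measurable w →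
      AEStronglyMeasurable (fun x => ∫⁻ y, g (x - y) * w y) volume := fun w hw =>
    (Measurable.lintegral_prod_right' (f := fun p : ESp N × ESp N => g (p.1 - p.2) * w p.2)
      (by fun_prop)).aestronglyMeasurable
  rw [split]
  refine (eLpNorm_add_le (hmT _ hm1) (hmT _ hm2) hq.le).trans ?_
  refine add_le_add (hC₁' _ hm1 (hI' h hm hd)) (hC₂' _ hm2 (fun y => ?_) (hJ' h hm h0 hd))
  rw [← ENNReal.ofReal_one]
  exact ENNReal.ofReal_le_ofReal (min_le_right _ _)

lemma weakNorm_top (N : ℕ) (f : ESp N → ℝ) : weakNorm N ∞ f = eLpNorm f ∞ volume := by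
  simp [weakNorm]

lemma weakNorm_of_ne_top {N : ℕ} {q : ℝ≥0∞} (hq : q ≠ ∞) (f : ESp N → ℝ) :
    weakNorm N q f = ⨆ (s : ℝ) (_ : 0 < s),
      ENNReal.ofReal s * (volume {x : ESp N | s < |f x|}) ^ q.toReal⁻¹ := by
  simp [weakNorm, hq]

/-- Chebyshev-type bound for the unit ball of weak `Lᵠ`. -/
lemma volume_lt_le_of_weakNorm_le_one {N : ℕ} {q : ℝ≥0∞} (hq : 1 < q) (hqt : q ≠ ∞)
    {f : ESp N → ℝ} (hf : weakNorm N q f ≤ 1) {s : ℝ} (hs : 0 < s) :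
    volume {x : ESp N | s < |f x|} ≤ ENNReal.ofReal (s ^ (-q.toReal)) := by
  have hq0 : 0 < q.toReal := ENNReal.toReal_pos (by positivity) hqt
  rw [weakNorm_of_ne_top hqt] at hf
  have h1 := (le_iSup₂ (f := fun (s : ℝ) (_ : 0 < s) =>
    ENNReal.ofReal s * (volume {x : ESp N | s < |f x|}) ^ q.toReal⁻¹) s hs).trans hf
  have h2 : (volume {x : ESp N | s < |f x|}) ^ q.toReal⁻¹ ≤ (ENNReal.ofReal s)⁻¹ := by
    rw [ENNReal.le_inv_iff_mul_le, mul_comm]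
    exact h1
  calc volume {x : ESp N | s < |f x|}
      = ((volume {x : ESp N | s < |f x|}) ^ q.toReal⁻¹) ^ q.toReal := by
        rw [← ENNReal.rpow_mul, inv_mul_cancel₀ hq0.ne', ENNReal.rpow_one]
    _ ≤ ((ENNReal.ofReal s)⁻¹) ^ q.toReal := ENNReal.rpow_le_rpow h2 hq0.le
    _ = _ := by
        rw [← ENNReal.ofReal_inv_of_pos hs, ENNReal.ofReal_rpow_of_pos (by positivity),
          rpow_neg hs.le, inv_rpow hs.le]

/-- Multiplication by `|x|^{-s}` maps weak `Lᵠ` into weak `Lᵃ` with `1/a = s/N + 1/q`. -/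
lemma volume_lt_norm_rpow_mul_le {N : ℕ} (hN : 1 ≤ N) {q : ℝ≥0∞} (hq : 1 < q) {f : ESp N → ℝ}
    (hf : weakNorm N q f ≤ 1) {s : ℝ} (hs : 0 < s) {l : ℝ} (hl : 0 < l) :
    volume {x : ESp N | l < ‖x‖ ^ (-s) * |f x|} ≤
      ENNReal.ofReal (((volume (Metric.ball (0 : ESp N) 1)).toReal + 1) *
        l ^ (-(s / N + q.toReal⁻¹)⁻¹)) := by
  have hN0 : (0 : ℝ) < N := by exact_mod_cast hN
  have : Nonempty (Fin N) := ⟨⟨0, hN⟩⟩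
  set b := q.toReal⁻¹ with hb
  have hb0 : 0 ≤ b := by positivity
  set a := (s / N + b)⁻¹ with ha
  have hab : a * (s / N + b) = 1 := inv_mul_cancel₀ (by positivity)
  set R := l ^ (-a / N) with hR
  have hR0 : 0 < R := by positivity
  have hsub : {x : ESp N | l < ‖x‖ ^ (-s) * |f x|} ⊆
      Metric.ball 0 R ∪ {x | l * R ^ s < |f x|} := by
    intro x hx
    by_cases hxR : x ∈ Metric.ball (0 : ESp N) R
    · exact Or.inl hxR
    right
    have hxR' : R ≤ ‖x‖ := by simpa using hxR
    have h1 : ‖x‖ ^ (-s) ≤ R ^ (-s) := rpow_le_rpow_of_nonpos hR0 hxR' (by linarith)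
    have h2 : l < R ^ (-s) * |f x| :=
      lt_of_lt_of_le hx (mul_le_mul_of_nonneg_right h1 (abs_nonneg _))
    rw [rpow_neg hR0.le, inv_mul_eq_div, lt_div_iff₀ (by positivity)] at h2
    exact h2
  have hball : volume (Metric.ball (0 : ESp N) R) =
      ENNReal.ofReal ((volume (Metric.ball (0 : ESp N) 1)).toReal * l ^ (-a)) := by
    rw [Measure.addHaar_ball _ _ hR0.le, finrank_euclideanSpace_fin, mul_comm,
      ENNReal.ofReal_mul ENNReal.toReal_nonneg, ENNReal.ofReal_toReal measure_ball_lt_top.ne,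
      ← Real.rpow_natCast, hR, ← rpow_mul hl.le]
    congr 3
    field_simp
  have hlR : l * R ^ s = l ^ (a * b) := by
    rw [hR, ← rpow_mul hl.le]
    nth_rewrite 1 [← rpow_one l]
    rw [← rpow_add hl]
    congr 1
    rw [← hab]
    ring
  have hrest : volume {x | l * R ^ s < |f x|} ≤ ENNReal.ofReal (l ^ (-a)) := by
    by_cases hqt : q = ∞
    · have hb1 : b = 0 := by simp [hb, hqt]
      rw [hlR, hb1, mul_zero, Real.rpow_zero]
      rw [hqt, weakNorm_top, eLpNorm_exponent_top] at hf
      have h0 : volume {x | 1 < |f x|} = 0 := by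
        have := (ae_le_eLpNormEssSup (f := f) (μ := volume)).mono fun x hx => hx.trans hf
        rw [ae_iff] at this
        convert this using 4 with x
        rw [← ofReal_norm, ← ENNReal.ofReal_one, ENNReal.ofReal_le_ofReal_iff
          zero_le_one, not_le, Real.norm_eq_abs]
      rw [h0]
      exact zero_le
    · have hq0 : 0 < q.toReal := ENNReal.toReal_pos (by positivity) hqt
      refine (volume_lt_le_of_weakNorm_le_one hq hqt hf (by positivity)).trans_eq ?_
      rw [hlR, ← rpow_mul hl.le]
      congr 2
      rw [hb]
      field_simp
  refine (measure_mono hsub).trans ((measure_union_le _ _).trans ?_)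
  rw [add_mul, one_mul, ENNReal.ofReal_add (by positivity) (by positivity), hball]
  gcongr

/-- A polynomially weighted Gaussian is dominated by a wider Gaussian. -/
lemma one_add_pow_mul_exp_le (n : ℕ) {r : ℝ} (hr : 0 ≤ r) :
    (1 + r) ^ n * Real.exp (-r ^ 2 / 4) ≤
      (n.factorial : ℝ) * Real.exp 3 * Real.exp (-r ^ 2 / 8) := by
  have h1 := Real.pow_div_factorial_le_exp (1 + r) (by linarith) n
  rw [div_le_iff₀ (by positivity)] at h1
  calc (1 + r) ^ n * Real.exp (-r ^ 2 / 4)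
      ≤ Real.exp (1 + r) * n.factorial * Real.exp (-r ^ 2 / 4) := by gcongr
    _ = n.factorial * Real.exp (1 + r + -r ^ 2 / 4) := by rw [Real.exp_add (1 + r)]; ring
    _ ≤ n.factorial * Real.exp (3 + -r ^ 2 / 8) := by
        have h2 : 1 + r + -r ^ 2 / 4 ≤ 3 + -r ^ 2 / 8 := by nlinarith [sq_nonneg (r - 4)]
        gcongr
    _ = _ := by rw [Real.exp_add]; ring

lemma norm_rpow_mul_heatKernel_one_le {N : ℕ} {γ : ℝ} (hγ : 0 < γ) :
    ∃ B : ℝ, 0 ≤ B ∧ ∀ x y : ESp N, ‖x‖ ^ γ * heatKernel N 1 (x - y) ≤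
      B * (Real.exp (-‖x - y‖ ^ 2 / 8) * (1 + ‖y‖ ^ γ)) := by
  obtain ⟨n, hn⟩ := exists_nat_ge γ
  refine ⟨(4 * π) ^ (-(N : ℝ) / 2) * 2 ^ γ * (n.factorial * Real.exp 3), by positivity,
    fun x y => ?_⟩
  have hx : ‖x‖ ^ γ ≤ 2 ^ γ * ((1 + ‖x - y‖) ^ n * (1 + ‖y‖ ^ γ)) := by
    have h1 : ‖x‖ ≤ 2 * max ‖x - y‖ ‖y‖ := by
      have := norm_add_le (x - y) y
      rw [sub_add_cancel] at this
      linarith [le_max_left ‖x - y‖ ‖y‖, le_max_right ‖x - y‖ ‖y‖]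
    have h2 : (max ‖x - y‖ ‖y‖) ^ γ ≤ (1 + ‖x - y‖) ^ n * (1 + ‖y‖ ^ γ) := by
      have hy : 0 ≤ ‖y‖ ^ γ := by positivity
      have hn1 : (1 : ℝ) ≤ (1 + ‖x - y‖) ^ n := one_le_pow₀ (by linarith [norm_nonneg (x - y)])
      rcases max_choice ‖x - y‖ ‖y‖ with h | h <;> rw [h]
      · calc ‖x - y‖ ^ γ ≤ (1 + ‖x - y‖) ^ γ := by gcongr; linarith
          _ ≤ (1 + ‖x - y‖) ^ (n : ℝ) :=
            rpow_le_rpow_of_exponent_le (by linarith [norm_nonneg (x - y)]) hn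
          _ = (1 + ‖x - y‖) ^ n := rpow_natCast _ _
          _ ≤ _ := le_mul_of_one_le_right (by positivity) (by linarith)
      · nlinarith
    calc ‖x‖ ^ γ ≤ (2 * max ‖x - y‖ ‖y‖) ^ γ := by gcongr
      _ = 2 ^ γ * (max ‖x - y‖ ‖y‖) ^ γ := mul_rpow (by norm_num) (by positivity)
      _ ≤ _ := by gcongr
  have h3 := one_add_pow_mul_exp_le n (norm_nonneg (x - y))
  rw [heatKernel, mul_one, mul_one]
  calc ‖x‖ ^ γ * ((4 * π) ^ (-(N : ℝ) / 2) * Real.exp (-‖x - y‖ ^ 2 / 4))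
      ≤ 2 ^ γ * ((1 + ‖x - y‖) ^ n * (1 + ‖y‖ ^ γ)) *
        ((4 * π) ^ (-(N : ℝ) / 2) * Real.exp (-‖x - y‖ ^ 2 / 4)) := by gcongr
    _ = (4 * π) ^ (-(N : ℝ) / 2) * 2 ^ γ * (1 + ‖y‖ ^ γ) *
        ((1 + ‖x - y‖) ^ n * Real.exp (-‖x - y‖ ^ 2 / 4)) := by ring
    _ ≤ (4 * π) ^ (-(N : ℝ) / 2) * 2 ^ γ * (1 + ‖y‖ ^ γ) *
        (n.factorial * Real.exp 3 * Real.exp (-‖x - y‖ ^ 2 / 8)) := by gcongr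
    _ = _ := by ring

lemma lintegral_exp_neg_sq_norm_ne_top (N : ℕ) :
    ∫⁻ x : ESp N, ENNReal.ofReal (Real.exp (-‖x‖ ^ 2 / 8)) ≠ ∞ := by
  have h := (GaussianFourier.integrable_cexp_neg_mul_sq_norm_add (V := ESp N) (b := 1 / 8)
    (by norm_num) 0 0).norm
  refine (Integrable.congr h (Eventually.of_forall fun x => ?_)).lintegral_lt_top.ne
  simp only [Complex.norm_exp]
  congr 1
  rw [inner_zero_left, Complex.ofReal_zero, mul_zero, add_zero, ← Complex.ofReal_pow,
    Complex.mul_re, Complex.ofReal_re, Complex.ofReal_im]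
  norm_num
  ring

/-- The smoothing estimate at time `1` on the unit ball of the weighted weak space. -/
lemma exists_eLpNorm_heatConv_one_le {N : ℕ} (hN : 1 ≤ N) {γ μ : ℝ} {q₁ q₂ : ℝ≥0∞}
    (hγ0 : 0 < γ) (hγμ : γ < μ) (hq₁ : 1 < q₁) (hq₂ : 1 < q₂)
    (h1 : q₂.toReal⁻¹ < (μ - γ) / N + q₁.toReal⁻¹) (h3 : μ / N + q₁.toReal⁻¹ < 1) :
    ∃ C : ℝ≥0∞, C ≠ ∞ ∧ ∀ v : ESp N → ℝ, Measurable v →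
      weakNorm N q₁ (fun x => ‖x‖ ^ μ * v x) ≤ 1 →
      eLpNorm (fun x => ‖x‖ ^ γ * heatConv N 1 v x) q₂ volume ≤ C := by
  have hN0 : (0 : ℝ) < N := by exact_mod_cast hN
  have hb0 : 0 ≤ q₁.toReal⁻¹ := by positivity
  have hlt : (μ - γ) / N + q₁.toReal⁻¹ < μ / N + q₁.toReal⁻¹ := by gcongr; linarith
  have hμγ0 : 0 < (μ - γ) / N := div_pos (by linarith) hN0
  set g : ESp N → ℝ≥0∞ := fun x => ENNReal.ofReal (Real.exp (-‖x‖ ^ 2 / 8)) with hgdef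
  have hg : Measurable g := by fun_prop
  have hg1 : ∀ x, g x ≤ 1 := fun x => by
    rw [hgdef, ← ENNReal.ofReal_one]
    refine ENNReal.ofReal_le_ofReal (Real.exp_le_one_iff.2 ?_)
    have := sq_nonneg ‖x‖
    linarith
  have hgi : ∫⁻ x, g x ≠ ∞ := lintegral_exp_neg_sq_norm_ne_top N
  set K : ℝ := (volume (Metric.ball (0 : ESp N) 1)).toReal + 1
  obtain ⟨C₁, hC₁, hC₁'⟩ := exists_eLpNorm_conv_le hg hg1 hgi hq₂ (K := K)
    (a := (μ / N + q₁.toReal⁻¹)⁻¹) ((one_lt_inv₀ (by linarith)).2 h3)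
    (by rw [inv_inv]; linarith)
  obtain ⟨C₂, hC₂, hC₂'⟩ := exists_eLpNorm_conv_le hg hg1 hgi hq₂ (K := K)
    (a := ((μ - γ) / N + q₁.toReal⁻¹)⁻¹) ((one_lt_inv₀ (by linarith)).2 (by linarith))
    (by rwa [inv_inv])
  obtain ⟨B, hB0, hB⟩ := norm_rpow_mul_heatKernel_one_le (N := N) hγ0
  refine ⟨(B.toNNReal : ℝ≥0∞) * (C₁ + C₂), ENNReal.mul_ne_top (by simp)
    (ENNReal.add_ne_top.2 ⟨hC₁, hC₂⟩), fun v hv hw => ?_⟩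
  have hker : ∀ z : ESp N, 0 ≤ heatKernel N 1 z := fun z => by
    rw [heatKernel]; positivity
  set w₁ : ESp N → ℝ := fun y => ‖y‖ ^ (-μ) * |‖y‖ ^ μ * v y| with hw₁
  set w₂ : ESp N → ℝ := fun y => ‖y‖ ^ (-(μ - γ)) * |‖y‖ ^ μ * v y| with hw₂
  have hm₁ : Measurable w₁ := by fun_prop
  have hm₂ : Measurable w₂ := by fun_prop
  have hn₁ : ∀ y, 0 ≤ w₁ y := fun y => by positivity
  have hn₂ : ∀ y, 0 ≤ w₂ y := fun y => by positivity
  have hT : ∀ w : ESp N → ℝ, Measurable w →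
      AEStronglyMeasurable (fun x => ∫⁻ y, g (x - y) * ENNReal.ofReal (w y)) volume :=
    fun w hw => (Measurable.lintegral_prod_right'
      (f := fun p : ESp N × ESp N => g (p.1 - p.2) * ENNReal.ofReal (w p.2))
      (by fun_prop)).aestronglyMeasurable
  have hsum : eLpNorm ((fun x => ∫⁻ y, g (x - y) * ENNReal.ofReal (w₁ y)) +
      (fun x => ∫⁻ y, g (x - y) * ENNReal.ofReal (w₂ y))) q₂ volume ≤ C₁ + C₂ := by
    refine (eLpNorm_add_le (hT _ hm₁) (hT _ hm₂) hq₂.le).trans (add_le_add ?_ ?_)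
    · exact hC₁' w₁ hm₁ hn₁ fun s hs => volume_lt_norm_rpow_mul_le hN hq₁ hw (by linarith) hs
    · exact hC₂' w₂ hm₂ hn₂ fun s hs => volume_lt_norm_rpow_mul_le hN hq₁ hw (by linarith) hs
  refine le_trans (eLpNorm_le_mul_eLpNorm_of_ae_le_mul' (c := B.toNNReal)
    (Eventually.of_forall fun x => ?_) q₂) (mul_le_mul_right hsum _)
  have hne : ∀ᵐ y : ESp N, y ≠ 0 := by
    have : Nonempty (Fin N) := ⟨⟨0, hN⟩⟩
    exact Measure.ae_ne volume 0
  rw [enorm_eq_self, Pi.add_apply, ← lintegral_add_left (by fun_prop),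
    ← lintegral_const_mul _ (by fun_prop), heatConv, ← integral_const_mul]
  refine (enorm_integral_le_lintegral_enorm _).trans (lintegral_mono_ae ?_)
  filter_upwards [hne] with y hy
  have hy0 : 0 < ‖y‖ := norm_pos_iff.2 hy
  have e₁ : w₁ y = |v y| := by
    rw [hw₁]
    simp only [abs_mul, abs_of_pos (rpow_pos_of_pos hy0 μ)]
    rw [← mul_assoc, ← rpow_add hy0, neg_add_cancel, Real.rpow_zero, one_mul]
  have e₂ : w₂ y = ‖y‖ ^ γ * |v y| := by
    rw [hw₂]
    simp only [abs_mul, abs_of_pos (rpow_pos_of_pos hy0 μ)]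
    rw [← mul_assoc, ← rpow_add hy0]
    congr 2
    ring
  rw [e₁, e₂, ← mul_add, ← ENNReal.ofReal_add (by positivity) (by positivity),
    ← ENNReal.ofReal_mul (by positivity), ENNReal.ofNNReal_toNNReal,
    ← ENNReal.ofReal_mul hB0, ← ofReal_norm]
  refine ENNReal.ofReal_le_ofReal ?_
  rw [← mul_assoc, norm_mul, Real.norm_eq_abs, Real.norm_eq_abs,
    abs_of_nonneg (mul_nonneg (by positivity) (hker _))]
  calc ‖x‖ ^ γ * heatKernel N 1 (x - y) * |v y|
      ≤ B * (Real.exp (-‖x - y‖ ^ 2 / 8) * (1 + ‖y‖ ^ γ)) * |v y| := by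
        exact mul_le_mul_of_nonneg_right (hB x y) (abs_nonneg _)
    _ = _ := by ring

lemma eLpNorm_comp_smul {N : ℕ} (f : ESp N → ℝ) (q : ℝ≥0∞) {c : ℝ} (hc : 0 < c) :
    eLpNorm (fun x => f (c • x)) q volume =
      ENNReal.ofReal (c ^ (-(N : ℝ) * q.toReal⁻¹)) * eLpNorm f q volume := by
  have he : MeasurableEmbedding fun x : ESp N => c • x :=
    (Homeomorph.smulOfNeZero c hc.ne').measurableEmbedding
  have h := he.eLpNorm_map_measure (μ := volume) (p := q) (g := f)
  rw [Measure.map_addHaar_smul _ hc.ne', eLpNorm_smul_measure_of_ne_zero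
    (ENNReal.ofReal_pos.2 (by positivity)).ne'] at h
  refine h.symm.trans ?_
  rw [smul_eq_mul, finrank_euclideanSpace_fin, abs_of_pos (by positivity),
    ENNReal.ofReal_rpow_of_pos (by positivity), ← Real.rpow_natCast, ← rpow_neg hc.le,
    ← rpow_mul hc.le]
  simp

lemma weakNorm_comp_smul_le {N : ℕ} (f : ESp N → ℝ) (q : ℝ≥0∞) {c : ℝ} (hc : 0 < c) :
    weakNorm N q (fun x => f (c • x)) ≤
      ENNReal.ofReal (c ^ (-(N : ℝ) * q.toReal⁻¹)) * weakNorm N q f := by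
  by_cases hq : q = ∞
  · subst hq
    rw [weakNorm_top, weakNorm_top, eLpNorm_comp_smul f _ hc]
  rw [weakNorm_of_ne_top hq, weakNorm_of_ne_top hq]
  refine iSup₂_le fun s hs => ?_
  have e : volume {x : ESp N | s < |f (c • x)|} =
      ENNReal.ofReal (c ^ (-(N : ℝ))) * volume {x : ESp N | s < |f x|} := by
    have := Measure.addHaar_preimage_smul (volume : Measure (ESp N)) hc.ne' {x | s < |f x|}
    rw [finrank_euclideanSpace_fin, abs_of_pos (by positivity), ← Real.rpow_natCast,
      ← rpow_neg hc.le] at this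
    exact this
  rw [e, ENNReal.mul_rpow_of_nonneg _ _ (by positivity), ENNReal.ofReal_rpow_of_pos
    (by positivity), ← rpow_mul hc.le, mul_left_comm]
  exact mul_le_mul_right (le_iSup₂ (f := fun (s : ℝ) (_ : 0 < s) =>
    ENNReal.ofReal s * (volume {x : ESp N | s < |f x|}) ^ q.toReal⁻¹) s hs) _

lemma weakNorm_const_mul_le {N : ℕ} (f : ESp N → ℝ) (q : ℝ≥0∞) {b : ℝ} (hb : 0 < b) :
    weakNorm N q (fun x => b * f x) ≤ ENNReal.ofReal b * weakNorm N q f := by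
  by_cases hq : q = ∞
  · subst hq
    rw [weakNorm_top, weakNorm_top]
    refine (eLpNorm_const_smul b f ∞ volume).le.trans_eq ?_
    rw [Real.enorm_eq_ofReal hb.le]
  rw [weakNorm_of_ne_top hq, weakNorm_of_ne_top hq]
  refine iSup₂_le fun s hs => ?_
  have e : {x : ESp N | s < |b * f x|} = {x : ESp N | s / b < |f x|} := by
    ext x
    show s < |b * f x| ↔ s / b < |f x|
    rw [abs_mul, abs_of_pos hb, div_lt_iff₀' hb]
  have e' : ENNReal.ofReal s = ENNReal.ofReal b * ENNReal.ofReal (s / b) := by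
    rw [← ENNReal.ofReal_mul hb.le, mul_div_cancel₀ _ hb.ne']
  rw [e, e', mul_assoc]
  exact mul_le_mul_right (le_iSup₂ (f := fun (s : ℝ) (_ : 0 < s) =>
    ENNReal.ofReal s * (volume {x : ESp N | s < |f x|}) ^ q.toReal⁻¹) (s / b)
      (by positivity)) _

lemma heatConv_sq_smul {N : ℕ} {c : ℝ} (hc : 0 < c) (u : ESp N → ℝ) (x : ESp N) :
    heatConv N (c ^ 2) u (c • x) = heatConv N 1 (fun y => u (c • y)) x := by
  have h := Measure.integral_comp_smul (volume : Measure (ESp N))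
    (fun y => heatKernel N (c ^ 2) (c • x - y) * u y) c
  rw [finrank_euclideanSpace_fin, abs_of_pos (by positivity), smul_eq_mul,
    eq_inv_mul_iff_mul_eq₀ (by positivity)] at h
  rw [heatConv, ← h, heatConv, ← integral_const_mul]
  congr 1 with y
  have e : (c ^ 2) ^ (-(N : ℝ) / 2) = (c ^ N)⁻¹ := by
    rw [← Real.rpow_natCast, ← Real.rpow_natCast, ← rpow_mul hc.le, ← rpow_neg hc.le]
    congr 1
    push_cast
    ring
  rw [heatKernel, heatKernel, ← smul_sub, norm_smul, Real.norm_of_nonneg hc.le,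
    mul_rpow (by positivity) (by positivity), e, mul_one]
  have e' : -(c * ‖x - y‖) ^ 2 / (4 * c ^ 2) = -‖x - y‖ ^ 2 / 4 := by
    field_simp
  rw [e', mul_one]
  field_simp

lemma heatConv_const_mul {N : ℕ} (t b : ℝ) (u : ESp N → ℝ) (x : ESp N) :
    heatConv N t (fun y => b * u y) x = b * heatConv N t u x := by
  simp only [heatConv]
  rw [← integral_const_mul]
  congr 1 with y
  ring

/-- Smoothing estimate for the heat semigroup in weighted Lorentz (weak) spaces. -/
theorem stmt1 (N : ℕ) (hN : 1 ≤ N) (γ μ : ℝ) (q₁ q₂ : ℝ≥0∞)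
    (hγ0 : 0 < γ) (hγμ : γ < μ) (hμN : μ < N)
    (hq₁ : 1 < q₁) (hq₂ : 1 < q₂)
    (h1 : q₂.toReal⁻¹ < (μ - γ) / N + q₁.toReal⁻¹)
    (h2 : (μ - γ) / N + q₁.toReal⁻¹ < μ / N + q₁.toReal⁻¹)
    (h3 : μ / N + q₁.toReal⁻¹ < 1) :
    ∃ C : ℝ, 0 < C ∧ ∀ t : ℝ, 0 < t → ∀ u : ESp N → ℝ, Measurable u →
      weakNorm N q₁ (fun x => ‖x‖ ^ μ * u x) < ∞ →
      eLpNorm (fun x => ‖x‖ ^ γ * heatConv N t u x) q₂ volume ≤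
        ENNReal.ofReal
            (C * t ^ (-(N : ℝ) / 2 * (q₁.toReal⁻¹ - q₂.toReal⁻¹) - (μ - γ) / 2)) *
          weakNorm N q₁ (fun x => ‖x‖ ^ μ * u x) := by
  obtain ⟨C, hC, hC'⟩ := exists_eLpNorm_heatConv_one_le hN hγ0 hγμ hq₁ hq₂ h1 h3
  refine ⟨C.toReal + 1, by positivity, fun t ht u hu hw => ?_⟩
  obtain ⟨c, hc, rfl⟩ : ∃ c : ℝ, 0 < c ∧ t = c ^ 2 :=
    ⟨√t, Real.sqrt_pos.2 ht, (Real.sq_sqrt ht.le).symm⟩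
  set W := weakNorm N q₁ (fun x => ‖x‖ ^ μ * u x) with hW
  set F : ESp N → ℝ := fun x => ‖x‖ ^ γ * heatConv N (c ^ 2) u x with hF
  set θ := -(N : ℝ) / 2 * (q₁.toReal⁻¹ - q₂.toReal⁻¹) - (μ - γ) / 2 with hθ
  have key : ∀ A : ℝ, 0 < A → W ≤ ENNReal.ofReal A →
      eLpNorm F q₂ volume ≤ C * ENNReal.ofReal ((c ^ 2) ^ θ * A) := by
    intro A hA hWA
    set b := c ^ (μ + N * q₁.toReal⁻¹) / A with hb
    have hb0 : 0 < b := by positivity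
    have hv : weakNorm N q₁ (fun x => ‖x‖ ^ μ * (b * u (c • x))) ≤ 1 := by
      have e : (fun x : ESp N => ‖x‖ ^ μ * (b * u (c • x))) =
          fun x => (b * c ^ (-μ)) * (‖c • x‖ ^ μ * u (c • x)) := by
        ext x
        rw [norm_smul, Real.norm_of_nonneg hc.le, mul_rpow hc.le (norm_nonneg _),
          rpow_neg hc.le]
        field_simp
      rw [e]
      calc _ ≤ ENNReal.ofReal (b * c ^ (-μ)) *
            (ENNReal.ofReal (c ^ (-(N : ℝ) * q₁.toReal⁻¹)) * ENNReal.ofReal A) := by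
            refine (weakNorm_const_mul_le (fun x : ESp N => ‖c • x‖ ^ μ * u (c • x)) q₁
              (by positivity)).trans (mul_le_mul_right ?_ _)
            exact (weakNorm_comp_smul_le (fun x : ESp N => ‖x‖ ^ μ * u x) q₁ hc).trans
              (mul_le_mul_right hWA _)
        _ = ENNReal.ofReal
            (c ^ (μ + N * q₁.toReal⁻¹) * c ^ (-μ) * c ^ (-(N : ℝ) * q₁.toReal⁻¹)) := by
            rw [← ENNReal.ofReal_mul (by positivity), ← ENNReal.ofReal_mul (by positivity), hb]
            congr 1
            field_simp
        _ = 1 := by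
            rw [← rpow_add hc, ← rpow_add hc]
            ring_nf
            simp
    have hbound := hC' _ (by fun_prop) hv
    have e : (fun x => ‖x‖ ^ γ * heatConv N 1 (fun y => b * u (c • y)) x) =
        (b * c ^ (-γ)) • fun x => F (c • x) := by
      ext x
      rw [Pi.smul_apply, smul_eq_mul, hF, heatConv_const_mul]
      dsimp only
      rw [norm_smul, Real.norm_of_nonneg hc.le, mul_rpow hc.le (norm_nonneg _), rpow_neg hc.le,
        heatConv_sq_smul hc]
      field_simp
    rw [e, eLpNorm_const_smul, eLpNorm_comp_smul F q₂ hc, Real.enorm_eq_ofReal (by positivity),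
      ← mul_assoc, ← ENNReal.ofReal_mul (by positivity)] at hbound
    have hprod : (c ^ 2) ^ θ * A * (b * c ^ (-γ) * c ^ (-(N : ℝ) * q₂.toReal⁻¹)) = 1 := by
      have e1 : (c ^ 2) ^ θ = c ^ (2 * θ) := by
        rw [← Real.rpow_natCast, ← rpow_mul hc.le]; norm_num
      calc _ = c ^ (2 * θ) * c ^ (μ + N * q₁.toReal⁻¹) * c ^ (-γ) *
            c ^ (-(N : ℝ) * q₂.toReal⁻¹) := by rw [e1, hb]; field_simp
        _ = 1 := by
          rw [← rpow_add hc, ← rpow_add hc, ← rpow_add hc, ← Real.rpow_zero c, hθ]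
          congr 1
          ring
    calc eLpNorm F q₂ volume
        = ENNReal.ofReal ((c ^ 2) ^ θ * A) *
          (ENNReal.ofReal (b * c ^ (-γ) * c ^ (-(N : ℝ) * q₂.toReal⁻¹)) *
            eLpNorm F q₂ volume) := by
          rw [← mul_assoc, ← ENNReal.ofReal_mul (by positivity), hprod, ENNReal.ofReal_one,
            one_mul]
      _ ≤ _ := by
          rw [mul_comm]
          exact mul_le_mul_left hbound _
  have hθ0 : 0 < (c ^ 2) ^ θ := by positivity
  have hlim : eLpNorm F q₂ volume ≤ C * ENNReal.ofReal ((c ^ 2) ^ θ) * W := by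
    have hk : C * ENNReal.ofReal ((c ^ 2) ^ θ) ≠ ∞ := ENNReal.mul_ne_top hC ENNReal.ofReal_ne_top
    refine ge_of_tendsto (x := nhdsWithin W.toReal (Ioi W.toReal))
      (f := fun A => C * ENNReal.ofReal ((c ^ 2) ^ θ) * ENNReal.ofReal A) ?_ ?_
    · have h := (ENNReal.continuous_const_mul hk).comp ENNReal.continuous_ofReal
      have h' := (h.tendsto W.toReal).mono_left (nhdsWithin_le_nhds (s := Ioi W.toReal))
      rwa [Function.comp_apply, ENNReal.ofReal_toReal hw.ne] at h'
    · filter_upwards [self_mem_nhdsWithin] with A hA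
      have hA : W.toReal < A := hA
      have := key A (ENNReal.toReal_nonneg.trans_lt hA)
        ((ENNReal.le_ofReal_iff_toReal_le hw.ne (ENNReal.toReal_nonneg.trans hA.le)).2 hA.le)
      rwa [ENNReal.ofReal_mul hθ0.le, ← mul_assoc] at this
  refine hlim.trans (mul_le_mul_left ?_ _)
  rw [ENNReal.ofReal_mul (by positivity)]
  refine mul_le_mul_left ?_ _
  rw [ENNReal.le_ofReal_iff_toReal_le hC (by positivity)]
  linarith
end
end

section
/- Let N ≥ 1, α > 0, 1 ≤ q ≤ ∞ with q > Nα/2, and let r satisfy 1 ≤ r/(α+1) ≤ q ≤ r; set β = (N/2)(1/q − 1/r). There exists a constant C > 0, depending only on N, α, q, r, such that for all T > 0, M > 0 and all jointly measurable u, v : (0,T] × ℝ^N → ℝ with sup_{t∈(0,T]} t^β ‖u(t,·)‖_r ≤ M and sup_{t∈(0,T]} t^β ‖v(t,·)‖_r ≤ M, one has for every t ∈ (0,T]: t^β ‖ x ↦ ∫_0^t (G_{t−σ} ⋆ (|u(σ,·)|^α u(σ,·) − |v(σ,·)|^α v(σ,·)))(x) dσ ‖_r ≤ C T^{1 − Nα/(2q)}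 M^α · sup_{s∈(0,T]} s^β ‖u(s,·) − v(s,·)‖_r. -/
open MeasureTheory Real Set ENNReal Filter

noncomputable section

theorem lintegral_mul_rpow_le_of_weight {X : Type*} [MeasurableSpace X] {μ : Measure X} {p : ℝ}
    (hp : 1 ≤ p) {w g : X → ℝ≥0∞} (hw : AEMeasurable w μ) (hg : AEMeasurable g μ) :
    (∫⁻ x, w x * g x ∂μ) ^ p ≤ (∫⁻ x, w x ∂μ) ^ (p - 1) * ∫⁻ x, w x * g x ^ p ∂μ := by
  rcases hp.eq_or_lt with rfl | hp
  · simp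
  have hp0 : 0 < p := by linarith
  have hpq : (p / (p - 1)).HolderConjugate p := by
    rw [Real.holderConjugate_iff]
    have : 0 < p - 1 := by linarith
    refine ⟨by rw [lt_div_iff₀ this]; linarith, by field_simp; ring⟩
  have h := ENNReal.lintegral_mul_le_Lp_mul_Lq μ hpq (f := fun x => w x ^ ((p - 1) / p))
    (g := fun x => w x ^ (1 / p) * g x) (hw.pow_const _) ((hw.pow_const _).mul hg)
  have h1 : ∀ x, ((fun x => w x ^ ((p - 1) / p)) * fun x => w x ^ (1 / p) * g x) x
      = w x * g x := by
    intro x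
    have hp1 : 0 ≤ p - 1 := by linarith
    simp only [Pi.mul_apply]
    rw [← mul_assoc, ← ENNReal.rpow_add_of_nonneg _ _ (by positivity) (by positivity)]
    rw [show (p - 1) / p + 1 / p = 1 by field_simp; ring, ENNReal.rpow_one]
  have h2 : ∀ x, (w x ^ ((p - 1) / p)) ^ (p / (p - 1)) = w x := by
    intro x
    have hp1 : p - 1 ≠ 0 := by linarith
    rw [← ENNReal.rpow_mul, show (p - 1) / p * (p / (p - 1)) = 1 by field_simp, ENNReal.rpow_one]
  have h3 : ∀ x, (w x ^ (1 / p) * g x) ^ p = w x * g x ^ p := by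
    intro x
    rw [ENNReal.mul_rpow_of_nonneg _ _ hp0.le, ← ENNReal.rpow_mul,
      show 1 / p * p = 1 by field_simp, ENNReal.rpow_one]
  simp only [h1, h2, h3] at h
  refine (ENNReal.rpow_le_rpow h hp0.le).trans_eq ?_
  have hp1 : p - 1 ≠ 0 := by linarith
  rw [ENNReal.mul_rpow_of_nonneg _ _ hp0.le, ← ENNReal.rpow_mul, ← ENNReal.rpow_mul,
    show 1 / p * p = 1 by field_simp, ENNReal.rpow_one,
    show 1 / (p / (p - 1)) * p = p - 1 by field_simp]

/-- Minkowski's integral inequality when the norms of the slices are dominated by a weight. -/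
theorem lintegral_lintegral_rpow_le_of_weight {X Y : Type*} [MeasurableSpace X]
    [MeasurableSpace Y] {μ : Measure X} {ν : Measure Y} [SFinite μ] [SFinite ν] {p : ℝ}
    (hp : 1 ≤ p) {w : Y → ℝ≥0∞} {F : Y → X → ℝ≥0∞} (hw : Measurable w)
    (hF : Measurable (Function.uncurry F)) (hw0 : ∀ᵐ s ∂ν, w s ≠ 0) (hwt : ∀ᵐ s ∂ν, w s ≠ ∞)
    {D : ℝ≥0∞} (h : ∀ᵐ s ∂ν, ∫⁻ x, F s x ^ p ∂μ ≤ w s ^ p * D) :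
    ∫⁻ x, (∫⁻ s, F s x ∂ν) ^ p ∂μ ≤ (∫⁻ s, w s ∂ν) ^ p * D := by
  have hp0 : 0 < p := by linarith
  have hFx : ∀ x, Measurable fun s => F s x := fun x => hF.comp measurable_prodMk_right
  have hFs : ∀ s, Measurable (F s) := fun s => hF.comp measurable_prodMk_left
  have key : ∀ x, (∫⁻ s, F s x ∂ν) ^ p ≤
      (∫⁻ s, w s ∂ν) ^ (p - 1) * ∫⁻ s, w s * (F s x / w s) ^ p ∂ν := by
    intro x
    refine le_trans (le_of_eq ?_)
      (lintegral_mul_rpow_le_of_weight hp hw.aemeasurable ((hFx x).div hw).aemeasurable)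
    congr 1
    refine lintegral_congr_ae ?_
    filter_upwards [hw0, hwt] with s h0 ht
    exact (ENNReal.mul_div_cancel h0 ht).symm
  have hm : Measurable (Function.uncurry fun x s => w s * (F s x / w s) ^ p) :=
    (hw.comp measurable_snd).mul
      (((hF.comp measurable_swap).div (hw.comp measurable_snd)).pow_const p)
  calc ∫⁻ x, (∫⁻ s, F s x ∂ν) ^ p ∂μ
      ≤ ∫⁻ x, (∫⁻ s, w s ∂ν) ^ (p - 1) * ∫⁻ s, w s * (F s x / w s) ^ p ∂ν ∂μ :=
        lintegral_mono key
    _ = (∫⁻ s, w s ∂ν) ^ (p - 1) * ∫⁻ s, ∫⁻ x, w s * (F s x / w s) ^ p ∂μ ∂ν := by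
        rw [lintegral_const_mul _ hm.lintegral_prod_right, lintegral_lintegral_swap hm.aemeasurable]
    _ ≤ (∫⁻ s, w s ∂ν) ^ (p - 1) * ∫⁻ s, w s * D ∂ν := by
        gcongr 1
        refine lintegral_mono_ae ?_
        filter_upwards [h, hw0, hwt] with s hs h0 ht
        have h0' : w s ^ p ≠ 0 := by simp [ENNReal.rpow_eq_zero_iff, h0, ht]
        have ht' : w s ^ p ≠ ∞ := ENNReal.rpow_ne_top_of_nonneg hp0.le ht
        simp_rw [ENNReal.div_rpow_of_nonneg _ _ hp0.le, div_eq_mul_inv]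
        rw [lintegral_const_mul _ (((hFs s).pow_const p).mul_const _),
          lintegral_mul_const _ ((hFs s).pow_const p)]
        gcongr 1
        rw [← div_eq_mul_inv]
        exact ENNReal.div_le_of_le_mul' hs
    _ = (∫⁻ s, w s ∂ν) ^ p * D := by
        rw [lintegral_mul_const _ hw, ← mul_assoc]
        congr 1
        nth_rewrite 2 [← ENNReal.rpow_one (∫⁻ s, w s ∂ν)]
        rw [← ENNReal.rpow_add_of_nonneg _ _ (by linarith) zero_le_one]
        simp

theorem heatKernel_nonneg (N : ℕ) {τ : ℝ} (hτ : 0 < τ) (z : ESp N) : 0 ≤ heatKernel N τ z := by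
  unfold heatKernel
  positivity

theorem heatKernel_le (N : ℕ) {τ : ℝ} (hτ : 0 < τ) (z : ESp N) :
    heatKernel N τ z ≤ (4 * π * τ) ^ (-(N : ℝ) / 2) := by
  unfold heatKernel
  refine mul_le_of_le_one_right (by positivity) (Real.exp_le_one_iff.2 ?_)
  exact div_nonpos_of_nonpos_of_nonneg (by simp) (by positivity)

theorem measurable_uncurry_heatKernel (N : ℕ) :
    Measurable (Function.uncurry (heatKernel N)) := by
  unfold heatKernel Function.uncurry
  fun_prop

theorem lintegral_heatKernel (N : ℕ) {τ : ℝ} (hτ : 0 < τ) :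
    ∫⁻ z, ENNReal.ofReal (heatKernel N τ z) = 1 := by
  have hb : 0 < (4 * τ)⁻¹ := by positivity
  have hg := GaussianFourier.integral_rexp_neg_mul_sq_norm (V := ESp N) hb
  have h : ∫ z, heatKernel N τ z = 1 := by
    unfold heatKernel
    rw [integral_const_mul]
    have : ∀ z : ESp N, -‖z‖ ^ 2 / (4 * τ) = -(4 * τ)⁻¹ * ‖z‖ ^ 2 := fun z => by ring
    simp_rw [this, hg, finrank_euclideanSpace_fin, div_inv_eq_mul]
    rw [show π * (4 * τ) = 4 * π * τ by ring, ← Real.rpow_add (by positivity)]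
    simp [neg_div]
  have hi : Integrable (heatKernel N τ) := by
    by_contra hc
    rw [integral_undef hc] at h
    exact zero_ne_one h
  rw [← ofReal_integral_eq_lintegral_ofReal hi (ae_of_all _ (heatKernel_nonneg N hτ)), h]
  simp

/-- The heat semigroup acting on nonnegative extended-valued functions. -/
def heatLConv (N : ℕ) (τ : ℝ) (F : ESp N → ℝ≥0∞) (x : ESp N) : ℝ≥0∞ :=
  ∫⁻ y, ENNReal.ofReal (heatKernel N τ (x - y)) * F y

theorem measurable_ofReal_heatKernel (N : ℕ) (τ : ℝ) :
    Measurable fun z => ENNReal.ofReal (heatKernel N τ z) :=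
  ((measurable_uncurry_heatKernel N).comp measurable_prodMk_left).ennreal_ofReal

theorem enorm_heatConv_le (N : ℕ) {τ : ℝ} (hτ : 0 < τ) (f : ESp N → ℝ) (x : ESp N) :
    ‖heatConv N τ f x‖ₑ ≤ heatLConv N τ (fun y => ‖f y‖ₑ) x := by
  refine (enorm_integral_le_lintegral_enorm _).trans_eq (lintegral_congr fun y => ?_)
  rw [enorm_mul, Real.enorm_eq_ofReal (heatKernel_nonneg N hτ _)]

theorem lintegral_heatLConv (N : ℕ) {τ : ℝ} (hτ : 0 < τ) {F : ESp N → ℝ≥0∞} (hF : Measurable F) :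
    ∫⁻ x, heatLConv N τ F x = ∫⁻ y, F y := by
  unfold heatLConv
  have hk := measurable_ofReal_heatKernel N τ
  rw [lintegral_lintegral_swap (((hk.comp measurable_sub).mul
    (hF.comp measurable_snd)).aemeasurable)]
  refine lintegral_congr fun y => ?_
  rw [lintegral_mul_const _ (by exact hk.comp (measurable_id.sub_const y)),
    lintegral_sub_right_eq_self (fun z => ENNReal.ofReal (heatKernel N τ z)) y,
    lintegral_heatKernel N hτ, one_mul]

theorem heatLConv_le_of_ae_le (N : ℕ) {τ : ℝ} (hτ : 0 < τ) {F : ESp N → ℝ≥0∞} {B : ℝ≥0∞}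
    (hF : ∀ᵐ y, F y ≤ B) (x : ESp N) : heatLConv N τ F x ≤ B := by
  have hk := measurable_ofReal_heatKernel N τ
  calc heatLConv N τ F x ≤ ∫⁻ y, ENNReal.ofReal (heatKernel N τ (x - y)) * B := by
        refine lintegral_mono_ae ?_
        filter_upwards [hF] with y hy
        gcongr
    _ = B := by
        rw [lintegral_mul_const _ (by exact hk.comp (measurable_id.const_sub x)),
          lintegral_sub_left_eq_self (fun z => ENNReal.ofReal (heatKernel N τ z)) x,
          lintegral_heatKernel N hτ, one_mul]

/-- The smoothing estimate of the heat semigroup from `L^p` to `L^{p(1+α)}`. -/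
theorem lintegral_heatLConv_rpow_le (N : ℕ) {τ p α : ℝ} (hτ : 0 < τ) (hp : 1 ≤ p) (hα : 0 ≤ α)
    {F : ESp N → ℝ≥0∞} (hF : Measurable F) :
    ∫⁻ x, heatLConv N τ F x ^ (p * (α + 1)) ≤
      ENNReal.ofReal ((4 * π * τ) ^ (-(N : ℝ) / 2)) ^ α * (∫⁻ y, F y ^ p) ^ (α + 1) := by
  have hk := measurable_ofReal_heatKernel N τ
  set A := ENNReal.ofReal ((4 * π * τ) ^ (-(N : ℝ) / 2))
  set I := ∫⁻ y, F y ^ p with hI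
  have hj : ∀ x, heatLConv N τ F x ^ p ≤ heatLConv N τ (fun y => F y ^ p) x := by
    intro x
    have hkx : Measurable fun y => ENNReal.ofReal (heatKernel N τ (x - y)) :=
      hk.comp (measurable_id.const_sub x)
    have := lintegral_mul_rpow_le_of_weight hp (μ := volume) hkx.aemeasurable hF.aemeasurable
    rwa [lintegral_sub_left_eq_self (fun z => ENNReal.ofReal (heatKernel N τ z)) x,
          lintegral_heatKernel N hτ, ENNReal.one_rpow, one_mul] at this
  have hs : ∀ x, heatLConv N τ (fun y => F y ^ p) x ≤ A * I := by
    intro x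
    rw [hI, ← lintegral_const_mul _ (hF.pow_const p)]
    refine lintegral_mono fun y => ?_
    gcongr
    exact ENNReal.ofReal_le_ofReal (heatKernel_le N hτ _)
  calc ∫⁻ x, heatLConv N τ F x ^ (p * (α + 1))
      ≤ ∫⁻ x, (A * I) ^ α * heatLConv N τ (fun y => F y ^ p) x := by
        refine lintegral_mono fun x => ?_
        rw [ENNReal.rpow_mul, ENNReal.rpow_add_of_nonneg _ _ hα zero_le_one, ENNReal.rpow_one]
        gcongr
        · exact (hj x).trans (hs x)
        · exact hj x
    _ = (A * I) ^ α * I := by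
        rw [lintegral_const_mul, lintegral_heatLConv N hτ (hF.pow_const p)]
        exact Measurable.lintegral_prod_right ((hk.comp measurable_sub).mul
          ((hF.pow_const p).comp measurable_snd))
    _ = A ^ α * I ^ (α + 1) := by
        rw [ENNReal.mul_rpow_of_nonneg _ _ hα, ENNReal.rpow_add_of_nonneg _ _ hα zero_le_one,
          ENNReal.rpow_one, mul_assoc]

theorem abs_abs_rpow_mul_sub_le {α : ℝ} (hα : 0 ≤ α) (a b : ℝ) :
    |(|a| ^ α * a - |b| ^ α * b)| ≤ (α + 1) * max |a| |b| ^ α * |a - b| := by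
  wlog hab : |b| ≤ |a| generalizing a b
  · rw [abs_sub_comm, max_comm, abs_sub_comm a b]
    exact this b a (le_of_not_ge hab)
  rw [max_eq_left hab]
  wlog ha : 0 ≤ a generalizing a b
  · have := this (-a) (-b) (by simpa using hab) (by linarith)
    simp only [abs_neg] at this
    rw [← abs_neg, ← abs_neg (a - b)]
    convert this using 2 <;> ring_nf
  rcases ha.eq_or_lt with rfl | ha
  · have : b = 0 := by simpa using hab
    simp [this]
  rw [abs_of_pos ha] at hab ⊢
  have haα : 0 < a ^ α := Real.rpow_pos_of_pos ha α
  have hb : |b| ^ α ≤ a ^ α := Real.rpow_le_rpow (abs_nonneg _) hab hα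
  have hb' : 0 ≤ |b| ^ α := by positivity
  have hba := abs_le.1 hab
  rw [abs_of_nonneg (a := a - b) (by linarith)]
  rcases le_total 0 b with h0 | h0
  · rw [abs_of_nonneg h0] at *
    have hB := one_add_mul_self_le_rpow_one_add (s := b / a - 1) (by
      have : 0 ≤ b / a := by positivity
      linarith) (p := α + 1) (by linarith)
    rw [add_sub_cancel, Real.div_rpow h0 ha.le, le_div_iff₀ (by positivity),
      Real.rpow_add_one' ha.le (by positivity), Real.rpow_add_one' h0 (by positivity)] at hB
    have e : (1 + (α + 1) * (b / a - 1)) * (a ^ α * a)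
        = a ^ α * a - (α + 1) * a ^ α * (a - b) := by field_simp; ring
    rw [abs_of_nonneg]
    · linarith
    · have := mul_le_mul hb hab h0 haα.le
      linarith
  · rw [abs_of_nonneg (by nlinarith)]
    rw [abs_of_nonpos h0] at *
    nlinarith [mul_nonneg (mul_nonneg hα haα.le) (by linarith : 0 ≤ a - b),
      mul_nonneg (sub_nonneg.2 hb) (neg_nonneg.2 h0)]

theorem enorm_abs_rpow_mul_sub_le {α : ℝ} (hα : 0 ≤ α) (a b : ℝ) :
    ‖|a| ^ α * a - |b| ^ α * b‖ₑ ≤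
      ENNReal.ofReal (α + 1) * max ‖a‖ₑ ‖b‖ₑ ^ α * ‖a - b‖ₑ := by
  simp only [Real.enorm_eq_ofReal_abs]
  rw [← ENNReal.ofReal_max, ENNReal.ofReal_rpow_of_nonneg (by positivity) hα,
    ← ENNReal.ofReal_mul (by positivity), ← ENNReal.ofReal_mul (by positivity)]
  exact ENNReal.ofReal_le_ofReal (abs_abs_rpow_mul_sub_le hα a b)

theorem lintegral_Ioo_rpow_neg {a t : ℝ} (ha : a < 1) (ht : 0 < t) :
    ∫⁻ s in Ioo 0 t, ENNReal.ofReal (s ^ (-a)) = ENNReal.ofReal (t ^ (1 - a) / (1 - a)) := by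
  have hi := (intervalIntegral.intervalIntegrable_rpow' (a := 0) (b := t)
    (by linarith : -1 < -a)).1
  rw [setLIntegral_congr Ioo_ae_eq_Ioc, ← ofReal_integral_eq_lintegral_ofReal hi,
    ← intervalIntegral.integral_of_le ht.le, integral_rpow (Or.inl (by linarith)),
    Real.zero_rpow (by linarith), sub_zero, neg_add_eq_sub]
  filter_upwards [ae_restrict_mem measurableSet_Ioc] with s hs
  exact Real.rpow_nonneg hs.1.le _

theorem lintegral_Ioo_comp_sub_left (f : ℝ → ℝ≥0∞) (t : ℝ) :
    ∫⁻ s in Ioo 0 t, f (t - s) = ∫⁻ s in Ioo 0 t, f s := by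
  rw [← lintegral_indicator measurableSet_Ioo, ← lintegral_indicator measurableSet_Ioo,
    ← lintegral_sub_left_eq_self ((Ioo 0 t).indicator f) t]
  refine lintegral_congr fun s => ?_
  have : s ∈ Ioo 0 t ↔ t - s ∈ Ioo 0 t := by
    simp only [mem_Ioo]
    constructor <;> rintro ⟨h1, h2⟩ <;> constructor <;> linarith
  by_cases hs : s ∈ Ioo 0 t
  · rw [indicator_of_mem hs, indicator_of_mem (this.1 hs)]
  · rw [indicator_of_notMem hs, indicator_of_notMem (fun h => hs (this.2 h))]

theorem lintegral_beta_kernel_le {a b t : ℝ} (ha0 : 0 ≤ a) (ha : a < 1) (hb0 : 0 ≤ b) (hb : b < 1)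
    (ht : 0 < t) :
    ∫⁻ s in Ioo 0 t, ENNReal.ofReal ((t - s) ^ (-a) * s ^ (-b)) ≤
      ENNReal.ofReal ((2 ^ a / (1 - b) + 2 ^ b / (1 - a)) * t ^ (1 - a - b)) := by
  have ha' : 0 < 1 - a := by linarith
  have hb' : 0 < 1 - b := by linarith
  have hpt : ∀ s ∈ Ioo 0 t, ENNReal.ofReal ((t - s) ^ (-a) * s ^ (-b)) ≤
      ENNReal.ofReal ((t / 2) ^ (-a)) * ENNReal.ofReal (s ^ (-b)) +
        ENNReal.ofReal ((t / 2) ^ (-b)) * ENNReal.ofReal ((t - s) ^ (-a)) := by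
    rintro s ⟨hs0, hst⟩
    have hts : 0 < t - s := by linarith
    rw [← ENNReal.ofReal_mul (by positivity), ← ENNReal.ofReal_mul (by positivity),
      ← ENNReal.ofReal_add (by positivity) (by positivity)]
    refine ENNReal.ofReal_le_ofReal ?_
    rcases le_total s (t / 2) with h | h
    · have : (t - s) ^ (-a) ≤ (t / 2) ^ (-a) :=
        Real.rpow_le_rpow_of_nonpos (by linarith) (by linarith) (by linarith)
      refine le_add_of_le_of_nonneg ?_ (by positivity)
      gcongr
    · have : s ^ (-b) ≤ (t / 2) ^ (-b) :=
        Real.rpow_le_rpow_of_nonpos (by linarith) (by linarith) (by linarith)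
      refine le_add_of_nonneg_of_le (by positivity) ?_
      rw [mul_comm]
      gcongr
  refine (setLIntegral_mono' measurableSet_Ioo hpt).trans ?_
  rw [lintegral_add_left (by fun_prop), lintegral_const_mul _ (by fun_prop),
    lintegral_const_mul _ (by fun_prop),
    lintegral_Ioo_comp_sub_left (fun s => ENNReal.ofReal (s ^ (-a))),
    lintegral_Ioo_rpow_neg ha ht, lintegral_Ioo_rpow_neg hb ht,
    ← ENNReal.ofReal_mul (by positivity), ← ENNReal.ofReal_mul (by positivity),
    ← ENNReal.ofReal_add (by positivity) (by positivity)]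
  refine ENNReal.ofReal_le_ofReal (le_of_eq ?_)
  rw [Real.div_rpow ht.le zero_le_two, Real.div_rpow ht.le zero_le_two, Real.rpow_neg zero_le_two,
    Real.rpow_neg zero_le_two, show 1 - a - b = -a + (1 - b) by ring, Real.rpow_add ht, add_mul]
  have : t ^ (-b) * t ^ (1 - a) = t ^ (-a) * t ^ (1 - b) := by
    rw [← Real.rpow_add ht, ← Real.rpow_add ht]
    ring_nf
  simp only [div_inv_eq_mul]
  congr 1
  · ring
  · rw [← this]
    ring

theorem lintegral_heatLConv_nonlinearity_le (N : ℕ) {τ p α : ℝ} (hτ : 0 < τ) (hp : 1 ≤ p)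
    (hα : 0 < α) {f g : ESp N → ℝ} (hf : Measurable f) (hg : Measurable g) {P Q : ℝ≥0∞}
    (hfP : ∫⁻ x, ‖f x‖ₑ ^ (p * (α + 1)) ≤ P ^ (p * (α + 1)))
    (hgP : ∫⁻ x, ‖g x‖ₑ ^ (p * (α + 1)) ≤ P ^ (p * (α + 1)))
    (hfg : ∫⁻ x, ‖f x - g x‖ₑ ^ (p * (α + 1)) ≤ Q ^ (p * (α + 1))) :
    ∫⁻ x, heatLConv N τ (fun y => ‖|f y| ^ α * f y - |g y| ^ α * g y‖ₑ) x ^ (p * (α + 1)) ≤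
      ENNReal.ofReal ((4 * π * τ) ^ (-(N : ℝ) / 2)) ^ α *
        (ENNReal.ofReal (α + 1) ^ (p * (α + 1)) * (2 * P ^ (p * (α + 1))) ^ α *
          Q ^ (p * (α + 1))) := by
  have hp0 : 0 < p := by linarith
  have hα1 : 0 < α + 1 := by linarith
  refine (lintegral_heatLConv_rpow_le N hτ hp hα.le (by fun_prop)).trans ?_
  gcongr 1
  have hm : Measurable fun x => max ‖f x‖ₑ ‖g x‖ₑ := hf.enorm.max hg.enorm
  have hd : Measurable fun x => ‖f x - g x‖ₑ := (hf.sub hg).enorm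
  have hmax : ∫⁻ x, max ‖f x‖ₑ ‖g x‖ₑ ^ (p * (α + 1)) ≤ 2 * P ^ (p * (α + 1)) := by
    calc ∫⁻ x, max ‖f x‖ₑ ‖g x‖ₑ ^ (p * (α + 1))
        ≤ ∫⁻ x, (‖f x‖ₑ ^ (p * (α + 1)) + ‖g x‖ₑ ^ (p * (α + 1))) := by
          refine lintegral_mono fun x => ?_
          rcases max_choice ‖f x‖ₑ ‖g x‖ₑ with h | h <;> simp only [h]
          · exact le_self_add
          · exact le_add_self
      _ ≤ 2 * P ^ (p * (α + 1)) := by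
          rw [lintegral_add_left (by fun_prop), two_mul]
          exact add_le_add hfP hgP
  have hpq : ((α + 1) / α).HolderConjugate (α + 1) := by
    rw [Real.holderConjugate_iff]
    refine ⟨by rw [lt_div_iff₀ hα]; linarith, by field_simp⟩
  have hH := ENNReal.lintegral_mul_le_Lp_mul_Lq volume hpq
    (f := fun x => max ‖f x‖ₑ ‖g x‖ₑ ^ (p * α)) (g := fun x => ‖f x - g x‖ₑ ^ p)
    (hm.pow_const _).aemeasurable (hd.pow_const _).aemeasurable
  simp only [Pi.mul_apply, ← ENNReal.rpow_mul] at hH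
  rw [show p * α * ((α + 1) / α) = p * (α + 1) by field_simp] at hH
  have hI : ∫⁻ y, ‖|f y| ^ α * f y - |g y| ^ α * g y‖ₑ ^ p ≤
      ENNReal.ofReal (α + 1) ^ p * ((2 * P ^ (p * (α + 1))) ^ (1 / ((α + 1) / α)) *
        (Q ^ (p * (α + 1))) ^ (1 / (α + 1))) := by
    calc ∫⁻ y, ‖|f y| ^ α * f y - |g y| ^ α * g y‖ₑ ^ p
        ≤ ∫⁻ y, ENNReal.ofReal (α + 1) ^ p *
            (max ‖f y‖ₑ ‖g y‖ₑ ^ (p * α) * ‖f y - g y‖ₑ ^ p) := by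
          refine lintegral_mono fun y => ?_
          rw [mul_comm p α, ENNReal.rpow_mul, ← mul_assoc, ← ENNReal.mul_rpow_of_nonneg _ _ hp0.le,
            ← ENNReal.mul_rpow_of_nonneg _ _ hp0.le]
          exact ENNReal.rpow_le_rpow (enorm_abs_rpow_mul_sub_le hα.le _ _) hp0.le
      _ ≤ _ := by
          rw [lintegral_const_mul _ (by exact (hm.pow_const _).mul (hd.pow_const _))]
          gcongr 1
          refine hH.trans ?_
          gcongr
  refine (ENNReal.rpow_le_rpow hI hα1.le).trans_eq ?_
  rw [ENNReal.mul_rpow_of_nonneg _ _ hα1.le, ENNReal.mul_rpow_of_nonneg _ _ hα1.le,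
    ← ENNReal.rpow_mul, ← ENNReal.rpow_mul (2 * _), ← ENNReal.rpow_mul (Q ^ _), mul_assoc,
    show 1 / ((α + 1) / α) * (α + 1) = α by field_simp,
    show 1 / (α + 1) * (α + 1) = 1 by field_simp, ENNReal.rpow_one]

theorem lintegral_rpow_le_of_weighted_eLpNorm_le {X E : Type*} [MeasurableSpace X] {μ : Measure X}
    [NormedAddCommGroup E] {r : ℝ≥0∞} (hr0 : r ≠ 0) (hr : r ≠ ∞) {f : X → E} {s β : ℝ}
    (hs : 0 < s) {S : ℝ≥0∞} (h : ENNReal.ofReal (s ^ β) * eLpNorm f r μ ≤ S) :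
    ∫⁻ x, ‖f x‖ₑ ^ r.toReal ∂μ ≤ (ENNReal.ofReal (s ^ (-β)) * S) ^ r.toReal := by
  have hr' : 0 < r.toReal := ENNReal.toReal_pos hr0 hr
  have h1 : eLpNorm f r μ ≤ ENNReal.ofReal (s ^ (-β)) * S := by
    calc eLpNorm f r μ = ENNReal.ofReal (s ^ (-β)) * (ENNReal.ofReal (s ^ β) * eLpNorm f r μ) := by
          rw [← mul_assoc, ← ENNReal.ofReal_mul (by positivity), ← Real.rpow_add hs]
          simp
      _ ≤ _ := by gcongr
  rw [eLpNorm_eq_lintegral_rpow_enorm_toReal hr0 hr] at h1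
  have h2 := ENNReal.rpow_le_rpow h1 hr'.le
  rwa [← ENNReal.rpow_mul, one_div_mul_cancel hr'.ne', ENNReal.rpow_one] at h2

theorem duhamel_weight_identity {n α p M τ s β : ℝ} (hα : 0 < α) (hp : 0 < p) (hM : 0 < M)
    (hτ : 0 < τ) (hs : 0 < s) :
    ((4 * π * τ) ^ (-n / 2)) ^ α * ((α + 1) ^ (p * (α + 1)) *
        (2 * (s ^ (-β) * M) ^ (p * (α + 1))) ^ α * (s ^ (-β)) ^ (p * (α + 1))) =
      (τ ^ (-(n * α / 2 / (p * (α + 1)))) * s ^ (-(β * (α + 1)))) ^ (p * (α + 1)) *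
        ((4 * π) ^ (-(n * α / 2 / (p * (α + 1)))) * (α + 1) * 2 ^ (α / (p * (α + 1))) *
          M ^ α) ^ (p * (α + 1)) := by
  have hα1 : 0 < α + 1 := by linarith
  refine Real.log_injOn_pos (by simp only [mem_Ioi]; positivity)
    (by simp only [mem_Ioi]; positivity) ?_
  simp (discharger := positivity) only [Real.log_mul, Real.log_rpow]
  field_simp
  ring

theorem enorm_duhamel_le (N : ℕ) (f : ℝ → ESp N → ℝ) (t : ℝ) (x : ESp N) :
    ‖∫ σ in Ioo 0 t, heatConv N (t - σ) (f σ) x‖ₑ ≤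
      ∫⁻ σ in Ioo 0 t, heatLConv N (t - σ) (fun y => ‖f σ y‖ₑ) x :=
  (enorm_integral_le_lintegral_enorm _).trans (setLIntegral_mono' measurableSet_Ioo
    fun _ hσ => enorm_heatConv_le N (sub_pos.2 hσ.2) _ _)

theorem measurable_uncurry_heatLConv (N : ℕ) (t : ℝ) {F : ℝ → ESp N → ℝ≥0∞}
    (hF : Measurable (Function.uncurry F)) :
    Measurable (Function.uncurry fun σ x => heatLConv N (t - σ) (F σ) x) := by
  have hk : Measurable fun z : (ℝ × ESp N) × ESp N => heatKernel N (t - z.1.1) (z.1.2 - z.2) :=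
    (measurable_uncurry_heatKernel N).comp
      ((measurable_fst.fst.const_sub t).prodMk (measurable_fst.snd.sub measurable_snd))
  have hF' : Measurable fun z : (ℝ × ESp N) × ESp N => F z.1.1 z.2 :=
    hF.comp (measurable_fst.fst.prodMk measurable_snd)
  exact (hk.ennreal_ofReal.mul hF').lintegral_prod_right'

theorem eLpNorm_duhamel_le (N : ℕ) {α p β t M : ℝ} (hα : 0 < α) (hp : 1 ≤ p) (hβ : 0 ≤ β)
    (hβ1 : β * (α + 1) < 1) (ha1 : (N : ℝ) * α / 2 / (p * (α + 1)) < 1) (ht : 0 < t) (hM : 0 < M)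
    {r : ℝ≥0∞} (hr : r ≠ ∞) (hrp : r.toReal = p * (α + 1)) {u v : ℝ → ESp N → ℝ}
    (hu : Measurable (Function.uncurry u)) (hv : Measurable (Function.uncurry v)) {S : ℝ≥0∞}
    (huM : ∀ s ∈ Ioc 0 t, ENNReal.ofReal (s ^ β) * eLpNorm (u s) r volume ≤ ENNReal.ofReal M)
    (hvM : ∀ s ∈ Ioc 0 t, ENNReal.ofReal (s ^ β) * eLpNorm (v s) r volume ≤ ENNReal.ofReal M)
    (huv : ∀ s ∈ Ioc 0 t,
      ENNReal.ofReal (s ^ β) * eLpNorm (fun x => u s x - v s x) r volume ≤ S) :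
    eLpNorm (fun x => ∫ σ in Ioo 0 t, heatConv N (t - σ)
        (fun y => |u σ y| ^ α * u σ y - |v σ y| ^ α * v σ y) x) r volume ≤
      ENNReal.ofReal ((2 ^ (N * α / 2 / (p * (α + 1))) / (1 - β * (α + 1)) +
          2 ^ (β * (α + 1)) / (1 - N * α / 2 / (p * (α + 1)))) *
            t ^ (1 - N * α / 2 / (p * (α + 1)) - β * (α + 1)) *
        ((4 * π) ^ (-(N * α / 2 / (p * (α + 1)))) * (α + 1) * 2 ^ (α / (p * (α + 1))) * M ^ α)) *
          S := by
  have hp0 : 0 < p := by linarith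
  have hα1 : 0 < α + 1 := by linarith
  have hρ0 : 0 < p * (α + 1) := by positivity
  have hρ1 : 1 ≤ p * (α + 1) := by nlinarith
  have hr0 : r ≠ 0 := by
    rintro rfl
    simp at hrp
    rcases hrp with h | h <;> linarith
  have hus : ∀ s, Measurable (u s) := fun s => hu.comp measurable_prodMk_left
  have hvs : ∀ s, Measurable (v s) := fun s => hv.comp measurable_prodMk_left
  set a := (N : ℝ) * α / 2 / (p * (α + 1)) with ha
  set b := β * (α + 1) with hb
  set c := (4 * π) ^ (-a) * (α + 1) * 2 ^ (α / (p * (α + 1))) * M ^ α with hc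
  have ha0 : 0 ≤ a := by positivity
  have hb0 : 0 ≤ b := by positivity
  have hc0 : 0 ≤ c := by positivity
  have hslice : ∀ σ ∈ Ioo 0 t,
      ∫⁻ x, heatLConv N (t - σ) (fun y => ‖|u σ y| ^ α * u σ y - |v σ y| ^ α * v σ y‖ₑ) x ^
          (p * (α + 1)) ≤
        ENNReal.ofReal ((t - σ) ^ (-a) * σ ^ (-b)) ^ (p * (α + 1)) *
          (ENNReal.ofReal c * S) ^ (p * (α + 1)) := by
    intro σ hσ
    have hσ0 : 0 < σ := hσ.1
    have hτ : 0 < t - σ := sub_pos.2 hσ.2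
    have hσ' : σ ∈ Ioc 0 t := ⟨hσ.1, hσ.2.le⟩
    have h1 := lintegral_rpow_le_of_weighted_eLpNorm_le hr0 hr hσ.1 (huM σ hσ')
    have h2 := lintegral_rpow_le_of_weighted_eLpNorm_le hr0 hr hσ.1 (hvM σ hσ')
    have h3 := lintegral_rpow_le_of_weighted_eLpNorm_le hr0 hr hσ.1 (huv σ hσ')
    rw [hrp] at h1 h2 h3
    refine (lintegral_heatLConv_nonlinearity_le N hτ hp hα (hus σ) (hvs σ) h1 h2 h3).trans_eq ?_
    rw [ENNReal.mul_rpow_of_nonneg _ S hρ0.le, ENNReal.mul_rpow_of_nonneg _ S hρ0.le]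
    simp only [← mul_assoc]
    congr 1
    have key := congrArg ENNReal.ofReal
      (duhamel_weight_identity (n := N) (β := β) hα hp0 hM hτ hσ0)
    rw [← ha, ← hb, ← hc] at key
    rw [show (2 : ℝ≥0∞) = ENNReal.ofReal 2 by simp]
    simp only [← mul_assoc] at key
    repeat rw [← ENNReal.ofReal_mul (by positivity)]
    repeat rw [ENNReal.ofReal_rpow_of_nonneg (by positivity) (by positivity)]
    repeat rw [← ENNReal.ofReal_mul (by positivity)]
    repeat rw [ENNReal.ofReal_rpow_of_nonneg (by positivity) (by positivity)]
    repeat rw [← ENNReal.ofReal_mul (by positivity)]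
    exact key
  have hF : Measurable (Function.uncurry fun σ y =>
      ‖|u σ y| ^ α * u σ y - |v σ y| ^ α * v σ y‖ₑ) := by
    have h : ∀ {w : ℝ → ESp N → ℝ}, Measurable (Function.uncurry w) →
        Measurable fun z : ℝ × ESp N => |w z.1 z.2| ^ α * w z.1 z.2 :=
      fun hw => (hw.abs.pow_const α).mul hw
    exact ((h hu).sub (h hv)).enorm
  have hM := lintegral_lintegral_rpow_le_of_weight (μ := (volume : Measure (ESp N)))
    (ν := volume.restrict (Ioo 0 t)) hρ1
    (w := fun σ => ENNReal.ofReal ((t - σ) ^ (-a) * σ ^ (-b))) (by fun_prop)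
    (measurable_uncurry_heatLConv N t hF)
    (by
      filter_upwards [ae_restrict_mem measurableSet_Ioo] with σ hσ
      have h1 : 0 < σ := hσ.1
      have h2 : 0 < t - σ := sub_pos.2 hσ.2
      exact (ENNReal.ofReal_pos.2 (by positivity)).ne')
    (ae_of_all _ fun _ => ENNReal.ofReal_ne_top)
    ((ae_restrict_mem measurableSet_Ioo).mono hslice)
  rw [eLpNorm_eq_lintegral_rpow_enorm_toReal hr0 hr, hrp, ENNReal.ofReal_mul' hc0, mul_assoc,
    one_div, ENNReal.rpow_inv_le_iff hρ0]
  calc _ ≤ _ := lintegral_mono fun x => ENNReal.rpow_le_rpow (enorm_duhamel_le N _ t x) hρ0.le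
    _ ≤ _ := hM
    _ ≤ _ := by
      rw [← ENNReal.mul_rpow_of_nonneg _ _ hρ0.le]
      gcongr
      exact lintegral_beta_kernel_le ha0 ha1 hb0 hβ1 ht

theorem eLpNorm_top_duhamel_le (N : ℕ) {α t M : ℝ} (hα : 0 ≤ α) (hM : 0 ≤ M)
    {u v : ℝ → ESp N → ℝ} {S : ℝ≥0∞}
    (huM : ∀ s ∈ Ioc 0 t, eLpNorm (u s) ∞ volume ≤ ENNReal.ofReal M)
    (hvM : ∀ s ∈ Ioc 0 t, eLpNorm (v s) ∞ volume ≤ ENNReal.ofReal M)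
    (huv : ∀ s ∈ Ioc 0 t, eLpNorm (fun x => u s x - v s x) ∞ volume ≤ S) :
    eLpNorm (fun x => ∫ σ in Ioo 0 t, heatConv N (t - σ)
        (fun y => |u σ y| ^ α * u σ y - |v σ y| ^ α * v σ y) x) ∞ volume ≤
      ENNReal.ofReal ((α + 1) * t * M ^ α) * S := by
  rw [eLpNorm_exponent_top]
  refine eLpNormEssSup_le_of_ae_enorm_bound (ae_of_all _ fun x => ?_)
  refine (enorm_duhamel_le N _ t x).trans ?_
  have h : ∀ σ ∈ Ioo 0 t, heatLConv N (t - σ)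
      (fun y => ‖|u σ y| ^ α * u σ y - |v σ y| ^ α * v σ y‖ₑ) x ≤
        ENNReal.ofReal (α + 1) * ENNReal.ofReal M ^ α * S := by
    intro σ hσ
    have hσ' : σ ∈ Ioc 0 t := ⟨hσ.1, hσ.2.le⟩
    refine heatLConv_le_of_ae_le N (sub_pos.2 hσ.2) ?_ x
    filter_upwards [ae_le_eLpNormEssSup (f := u σ) (μ := volume),
      ae_le_eLpNormEssSup (f := v σ) (μ := volume),
      ae_le_eLpNormEssSup (f := fun x => u σ x - v σ x) (μ := volume)] with y h1 h2 h3
    refine (enorm_abs_rpow_mul_sub_le hα _ _).trans ?_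
    gcongr
    · exact max_le (h1.trans (huM σ hσ')) (h2.trans (hvM σ hσ'))
    · exact h3.trans (huv σ hσ')
  refine (setLIntegral_mono' measurableSet_Ioo h).trans_eq ?_
  rw [setLIntegral_const, Real.volume_Ioo, sub_zero, ENNReal.ofReal_mul' (by positivity),
    ENNReal.ofReal_mul (by positivity), ENNReal.ofReal_rpow_of_nonneg hM hα]
  ring

/-- The contraction estimate for the Duhamel term of the nonlinear heat equation
in the space `Y_{M,T}^{q,r}`. Here `β = (N/2)(1/q - 1/r)`. -/
theorem stmt4 (N : ℕ) (hN : 1 ≤ N) (α : ℝ) (hα : 0 < α) (q r : ℝ≥0∞)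
    (hq1 : 1 ≤ q) (hq : ENNReal.ofReal ((N : ℝ) * α / 2) < q)
    (hr1 : 1 ≤ r / ENNReal.ofReal (α + 1))
    (hrq : r / ENNReal.ofReal (α + 1) ≤ q) (hqr : q ≤ r) :
    ∃ C : ℝ, 0 < C ∧ ∀ T M : ℝ, 0 < T → 0 < M →
      ∀ u v : ℝ → ESp N → ℝ,
        Measurable (Function.uncurry u) → Measurable (Function.uncurry v) →
        (∀ s ∈ Set.Ioc (0 : ℝ) T,
          ENNReal.ofReal (s ^ ((N : ℝ) / 2 * (q.toReal⁻¹ - r.toReal⁻¹))) *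
            eLpNorm (u s) r volume ≤ ENNReal.ofReal M) →
        (∀ s ∈ Set.Ioc (0 : ℝ) T,
          ENNReal.ofReal (s ^ ((N : ℝ) / 2 * (q.toReal⁻¹ - r.toReal⁻¹))) *
            eLpNorm (v s) r volume ≤ ENNReal.ofReal M) →
        ∀ t ∈ Set.Ioc (0 : ℝ) T,
          ENNReal.ofReal (t ^ ((N : ℝ) / 2 * (q.toReal⁻¹ - r.toReal⁻¹))) *
            eLpNorm (fun x => ∫ σ in Set.Ioo (0 : ℝ) t,
              heatConv N (t - σ)
                (fun y => |u σ y| ^ α * u σ y - |v σ y| ^ α * v σ y) x) r volume ≤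
          ENNReal.ofReal (C * T ^ (1 - (N : ℝ) * α / 2 * q.toReal⁻¹) * M ^ α) *
            ⨆ (s : ℝ) (_ : s ∈ Set.Ioc (0 : ℝ) T),
              ENNReal.ofReal (s ^ ((N : ℝ) / 2 * (q.toReal⁻¹ - r.toReal⁻¹))) *
                eLpNorm (fun x => u s x - v s x) r volume := by
  have hα1 : 0 < α + 1 := by linarith
  have hα1' : ENNReal.ofReal (α + 1) ≠ 0 := (ENNReal.ofReal_pos.2 hα1).ne'
  by_cases hr : r = ∞
  · subst hr
    have hq' : q = ∞ := by
      rw [ENNReal.top_div_of_ne_top ENNReal.ofReal_ne_top] at hrq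
      exact top_le_iff.1 hrq
    subst hq'
    refine ⟨α + 1, hα1, fun T M hT hM u v _ _ huM hvM t ht => ?_⟩
    simp only [ENNReal.toReal_top, _root_.inv_zero, sub_zero, mul_zero, Real.rpow_zero,
      ENNReal.ofReal_one, one_mul, Real.rpow_one] at huM hvM ⊢
    have hsub : ∀ {s}, s ∈ Ioc 0 t → s ∈ Ioc 0 T := fun hs => ⟨hs.1, hs.2.trans ht.2⟩
    refine (eLpNorm_top_duhamel_le N hα.le hM.le (fun s hs => huM s (hsub hs))
      (fun s hs => hvM s (hsub hs))
      (S := ⨆ (s : ℝ) (_ : s ∈ Set.Ioc (0 : ℝ) T), eLpNorm (fun x => u s x - v s x) ∞ volume)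
      (fun s hs => le_iSup₂_of_le s (hsub hs) le_rfl)).trans ?_
    gcongr
    exact ht.2
  have hqt : q ≠ ∞ := ne_top_of_le_ne_top hr hqr
  set κ := q.toReal with hκ
  set ρ := r.toReal with hρ
  have hκ1 : 1 ≤ κ := (ENNReal.ofReal_le_iff_le_toReal hqt).1 (by simpa using hq1)
  have hκρ : κ ≤ ρ := ENNReal.toReal_mono hr hqr
  have hκN : N * α / 2 < κ := (ENNReal.ofReal_lt_iff_lt_toReal (by positivity) hqt).1 hq
  have hdiv : (r / ENNReal.ofReal (α + 1)).toReal = ρ / (α + 1) := by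
    rw [ENNReal.toReal_div, ENNReal.toReal_ofReal hα1.le]
  have hdivt : r / ENNReal.ofReal (α + 1) ≠ ∞ := ENNReal.div_ne_top hr hα1'
  obtain ⟨p, hp⟩ : ∃ p, p = ρ / (α + 1) := ⟨_, rfl⟩
  rw [← hp] at hdiv
  have hp1 : 1 ≤ p := by
    rw [← hdiv]
    exact (ENNReal.ofReal_le_iff_le_toReal hdivt).1 (by simpa using hr1)
  have hpκ : p ≤ κ := by
    rw [← hdiv]
    exact ENNReal.toReal_mono hqt hrq
  have hρp : ρ = p * (α + 1) := by rw [hp]; field_simp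
  have hp0 : 0 < p := by linarith
  have hκ0 : 0 < κ := by linarith
  have hρ0 : 0 < ρ := by linarith
  have hNα : 0 ≤ (N : ℝ) * α / 2 := by positivity
  obtain ⟨β, hβ⟩ : ∃ β, β = (N : ℝ) / 2 * (κ⁻¹ - ρ⁻¹) := ⟨_, rfl⟩
  rw [← hβ]
  have hβ0 : 0 ≤ β := by
    have := inv_anti₀ hκ0 hκρ
    rw [hβ]
    exact mul_nonneg (by positivity) (by linarith)
  have hβ1 : β * (α + 1) < 1 := by
    have h1 : κ⁻¹ ≤ p⁻¹ := inv_anti₀ hp0 hpκ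
    have h2 : ρ⁻¹ * (α + 1) = p⁻¹ := by rw [hρp]; field_simp
    calc β * (α + 1) = N / 2 * (κ⁻¹ * (α + 1) - p⁻¹) := by rw [hβ, ← h2]; ring
      _ ≤ N / 2 * (κ⁻¹ * (α + 1) - κ⁻¹) := by gcongr
      _ = N * α / 2 / κ := by ring
      _ < 1 := (div_lt_one hκ0).2 hκN
  have ha1 : (N : ℝ) * α / 2 / (p * (α + 1)) < 1 := by
    rw [← hρp]
    exact (div_lt_one hρ0).2 (by linarith)
  have hβ1' := sub_pos.2 hβ1
  have ha1' := sub_pos.2 ha1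
  refine ⟨(2 ^ (N * α / 2 / (p * (α + 1))) / (1 - β * (α + 1)) +
      2 ^ (β * (α + 1)) / (1 - N * α / 2 / (p * (α + 1)))) *
    ((4 * π) ^ (-(N * α / 2 / (p * (α + 1)))) * (α + 1) * 2 ^ (α / (p * (α + 1)))),
    by positivity, fun T M hT hM u v hu hv huM hvM t ht => ?_⟩
  have ht0 : 0 < t := ht.1
  have hsub : ∀ {s}, s ∈ Ioc 0 t → s ∈ Ioc 0 T := fun hs => ⟨hs.1, hs.2.trans ht.2⟩
  have hmain := eLpNorm_duhamel_le N hα hp1 hβ0 hβ1 ha1 ht0 hM hr hρp hu hv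
    (fun s hs => huM s (hsub hs)) (fun s hs => hvM s (hsub hs))
    (S := ⨆ (s : ℝ) (_ : s ∈ Set.Ioc (0 : ℝ) T),
      ENNReal.ofReal (s ^ β) * eLpNorm (fun x => u s x - v s x) r volume)
    (fun s hs => le_iSup₂_of_le s (hsub hs) le_rfl)
  refine (mul_le_mul_right hmain _).trans ?_
  rw [← mul_assoc, ← ENNReal.ofReal_mul (by positivity)]
  gcongr ENNReal.ofReal ?_ * _
  have hexp : t ^ β * t ^ (1 - N * α / 2 / (p * (α + 1)) - β * (α + 1)) =
      t ^ (1 - N * α / 2 * κ⁻¹) := by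
    rw [← Real.rpow_add ht0]
    congr 1
    rw [hβ, ← hρp]
    ring
  have hmono : t ^ (1 - N * α / 2 * κ⁻¹) ≤ T ^ (1 - N * α / 2 * κ⁻¹) := by
    refine Real.rpow_le_rpow ht0.le ht.2 ?_
    rw [← div_eq_mul_inv, sub_nonneg]
    exact ((div_lt_one hκ0).2 hκN).le
  refine le_trans (le_of_eq ?_) (mul_le_mul_of_nonneg_right
    (mul_le_mul_of_nonneg_left hmono (by positivity)) (by positivity))
  rw [← hexp]
  ring
end
end

section
/- Let N ≥ 1, 0 < α < 2/N, and let 𝔪 be a nonzero positive finite Borel measure on ℝ^N. Then: (i) for every λ > 0, the set of T > 0 for which there exists a nonnegative mild solution of ∂_t u = Δu + u^{α+1} on (0,T) with initial datum λ𝔪 is bounded above; and (ii) for every δ > 0 there exists λ₀ > 0 such that for all 0 < λ ≤ λ₀ and all such T, λ^{(1/α − N/2)^{−1}} T ≤ (α^{1/α} (4π)^{−N/2} 𝔪(ℝ^N))^{−(1/α − N/2)^{−1}} + δ. -/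
open MeasureTheory Real Set ENNReal Filter

noncomputable section

/-- A nonnegative mild solution of `∂ₜu = Δu + u^{α+1}` on `(0,T)` with a positive
finite Borel measure `μ₀` as initial datum:  jointly measurable, finite a.e. for
each time, and for every `t ∈ (0,T)` and a.e. `x` the Duhamel formula holds, where
all integrals are (possibly infinite) integrals of nonnegative functions. -/
def IsNonnegMildSolutionMeas (N : ℕ) (α T : ℝ) (μ₀ : Measure (ESp N))
    (u : ℝ → ESp N → ℝ≥0∞) : Prop :=
  Measurable (Function.uncurry u) ∧
  ∀ t ∈ Set.Ioo (0 : ℝ) T,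
    (∀ᵐ x : ESp N ∂volume, u t x < ∞) ∧
    ∀ᵐ x : ESp N ∂volume,
      u t x = (∫⁻ y, ENNReal.ofReal (heatKernel N t (x - y)) ∂μ₀) +
        ∫⁻ σ in Set.Ioo (0 : ℝ) t,
          ∫⁻ y, ENNReal.ofReal (heatKernel N (t - σ) (x - y)) * u σ y ^ (α + 1)

lemma measurable_heatKernel (N : ℕ) :
    Measurable (fun p : ℝ × ESp N => heatKernel N p.1 p.2) := by
  unfold heatKernel
  fun_prop

lemma heatKernel_nonneg_s11 (N : ℕ) {t : ℝ} (ht : 0 < t) (x : ESp N) : 0 ≤ heatKernel N t x := by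
  unfold heatKernel; positivity

lemma lintegral_exp_neg_mul_sq_norm (N : ℕ) {c : ℝ} (hc : 0 < c) (m : ESp N) :
    ∫⁻ y : ESp N, ENNReal.ofReal (Real.exp (-c * ‖y - m‖ ^ 2)) =
      ENNReal.ofReal ((π / c) ^ ((N : ℝ) / 2)) := by
  rw [lintegral_sub_right_eq_self (fun y : ESp N => ENNReal.ofReal (Real.exp (-c * ‖y‖ ^ 2))) m]
  have h := GaussianFourier.integral_rexp_neg_mul_sq_norm (V := ESp N) hc
  have hi : Integrable (fun v : ESp N => Real.exp (-c * ‖v‖ ^ 2)) := by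
    by_contra hn
    rw [integral_undef hn] at h
    have : 0 < (π / c) ^ ((Module.finrank ℝ (ESp N) : ℝ) / 2) := by positivity
    linarith
  rw [← ofReal_integral_eq_lintegral_ofReal hi (ae_of_all _ fun _ => (Real.exp_pos _).le), h]
  simp

lemma lintegral_heatKernel_s11 (N : ℕ) {t : ℝ} (ht : 0 < t) (x : ESp N) :
    ∫⁻ y : ESp N, ENNReal.ofReal (heatKernel N t (x - y)) = 1 := by
  have hc : 0 < 1 / (4 * t) := by positivity
  have h : ∀ y : ESp N, ENNReal.ofReal (heatKernel N t (x - y)) =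
      ENNReal.ofReal ((4 * π * t) ^ (-(N : ℝ) / 2)) *
        ENNReal.ofReal (Real.exp (-(1 / (4 * t)) * ‖y - x‖ ^ 2)) := by
    intro y
    rw [heatKernel, ENNReal.ofReal_mul (by positivity), norm_sub_rev]
    congr 3
    ring
  simp_rw [h]
  rw [lintegral_const_mul _ (by fun_prop), lintegral_exp_neg_mul_sq_norm N hc,
    ← ENNReal.ofReal_mul (by positivity)]
  rw [show π / (1 / (4 * t)) = 4 * π * t by field_simp, ← Real.rpow_add (by positivity)]
  rw [show -(N : ℝ) / 2 + (N : ℝ) / 2 = 0 by ring]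
  simp

lemma norm_sq_add_norm_sq_div {E : Type*} [NormedAddCommGroup E] [InnerProductSpace ℝ E]
    {a b : ℝ} (ha : 0 < a) (hb : 0 < b) (x y z : E) :
    ‖x - y‖ ^ 2 / a + ‖y - z‖ ^ 2 / b = ‖x - z‖ ^ 2 / (a + b) +
      (a + b) / (a * b) * ‖y - (a + b)⁻¹ • (b • x + a • z)‖ ^ 2 := by
  have hab : a + b ≠ 0 := by positivity
  simp only [← real_inner_self_eq_norm_sq, inner_sub_left, inner_sub_right, inner_add_right,
    real_inner_smul_right, real_inner_comm]
  field_simp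
  ring

lemma lintegral_heatKernel_mul_heatKernel (N : ℕ) {a b : ℝ} (ha : 0 < a) (hb : 0 < b)
    (x z : ESp N) :
    ∫⁻ y : ESp N, ENNReal.ofReal (heatKernel N a (x - y)) *
      ENNReal.ofReal (heatKernel N b (y - z)) = ENNReal.ofReal (heatKernel N (a + b) (x - z)) := by
  set m : ESp N := (a + b)⁻¹ • (b • x + a • z)
  have hc : 0 < (a + b) / (4 * a * b) := by positivity
  have h : ∀ y : ESp N, ENNReal.ofReal (heatKernel N a (x - y)) *
      ENNReal.ofReal (heatKernel N b (y - z)) =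
      ENNReal.ofReal ((4 * π * a) ^ (-(N : ℝ) / 2) * (4 * π * b) ^ (-(N : ℝ) / 2) *
        Real.exp (-‖x - z‖ ^ 2 / (4 * (a + b)))) *
        ENNReal.ofReal (Real.exp (-((a + b) / (4 * a * b)) * ‖y - m‖ ^ 2)) := by
    intro y
    rw [← ENNReal.ofReal_mul (heatKernel_nonneg_s11 N ha _), ← ENNReal.ofReal_mul (by positivity)]
    congr 1
    have e : -‖x - y‖ ^ 2 / (4 * a) + -‖y - z‖ ^ 2 / (4 * b) =
        -‖x - z‖ ^ 2 / (4 * (a + b)) + -((a + b) / (4 * a * b)) * ‖y - m‖ ^ 2 := by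
      have := norm_sq_add_norm_sq_div ha hb x y z
      change _ = _ + _ * ‖y - m‖ ^ 2 at this
      calc _ = -(1 / 4) * (‖x - y‖ ^ 2 / a + ‖y - z‖ ^ 2 / b) := by field_simp; ring
        _ = _ := by rw [this]; field_simp; ring
    rw [heatKernel, heatKernel, mul_mul_mul_comm, ← Real.exp_add, e, Real.exp_add]
    ring
  simp_rw [h]
  rw [lintegral_const_mul _ (by fun_prop), lintegral_exp_neg_mul_sq_norm N hc,
    ← ENNReal.ofReal_mul (by positivity), heatKernel]
  congr 1
  rw [mul_right_comm]
  congr 1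
  have e : (π / ((a + b) / (4 * a * b))) ^ ((N : ℝ) / 2) =
      ((a + b) / (4 * a * b * π)) ^ (-(N : ℝ) / 2) := by
    rw [neg_div, Real.rpow_neg (by positivity), ← Real.inv_rpow (by positivity)]
    congr 1
    field_simp
  rw [e, ← Real.mul_rpow (by positivity) (by positivity),
    ← Real.mul_rpow (by positivity) (by positivity)]
  congr 1
  field_simp

lemma rpow_lintegral_mul_le {X : Type*} [MeasurableSpace X] (μ : Measure X) {g f : X → ℝ≥0∞}
    (hg : Measurable g) (hf : Measurable f) (hg1 : ∫⁻ x, g x ∂μ = 1) {p : ℝ} (hp : 1 ≤ p) :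
    (∫⁻ x, g x * f x ∂μ) ^ p ≤ ∫⁻ x, g x * f x ^ p ∂μ := by
  have hprob : IsProbabilityMeasure (μ.withDensity g) := ⟨by simp [hg1]⟩
  have h := eLpNorm'_le_eLpNorm'_of_exponent_le (p := 1) (q := p) one_pos hp (μ.withDensity g)
    (f := f) hf.aestronglyMeasurable
  simp only [eLpNorm', ENNReal.rpow_one, div_one, enorm_eq_self] at h
  rw [lintegral_withDensity_eq_lintegral_mul _ hg hf,
    lintegral_withDensity_eq_lintegral_mul _ hg (hf.pow_const p),
    one_div, ENNReal.le_rpow_inv_iff (by linarith)] at h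
  exact h

lemma lintegral_Ioo_add_le_of_rpow_le {p : ℝ} (hp : 0 < p) {t : ℝ} {A : ℝ≥0∞} {J : ℝ → ℝ≥0∞}
    (hineq : ∀ s ∈ Set.Ioo 0 t, (A + ∫⁻ σ in Set.Ioo 0 s, J σ) ^ p ≤ J s)
    {x z : ℝ} (hx : 0 ≤ x) (hxz : x ≤ z) (hz : z ≤ t) :
    (A + ∫⁻ σ in Set.Ioo 0 x, J σ) + ENNReal.ofReal (z - x) * (A + ∫⁻ σ in Set.Ioo 0 x, J σ) ^ p ≤
      A + ∫⁻ σ in Set.Ioo 0 z, J σ := by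
  have h1 : ENNReal.ofReal (z - x) * (A + ∫⁻ σ in Set.Ioo 0 x, J σ) ^ p ≤
      ∫⁻ σ in Set.Ioo x z, J σ := by
    calc _ = ∫⁻ σ in Set.Ioo x z, (A + ∫⁻ σ in Set.Ioo 0 x, J σ) ^ p := by
          rw [setLIntegral_const, Real.volume_Ioo, mul_comm]
      _ ≤ _ := by
          refine setLIntegral_mono' measurableSet_Ioo fun σ hσ => ?_
          refine le_trans ?_ (hineq σ ⟨hx.trans_lt hσ.1, hσ.2.trans_le hz⟩)
          refine ENNReal.rpow_le_rpow ?_ hp.le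
          gcongr
          exact hσ.1.le
  have h2 : (∫⁻ σ in Set.Ioo 0 x, J σ) + ∫⁻ σ in Set.Ioo x z, J σ ≤
      ∫⁻ σ in Set.Ioo 0 z, J σ := by
    rw [← lintegral_union measurableSet_Ioo]
    · refine lintegral_mono_set ?_
      rintro σ (h | h)
      · exact ⟨h.1, h.2.trans_le hxz⟩
      · exact ⟨hx.trans_lt h.1, h.2⟩
    · rw [Set.disjoint_left]
      intro σ h h'
      exact lt_asymm h.2 h'.1
  calc _ ≤ (A + ∫⁻ σ in Set.Ioo 0 x, J σ) + ∫⁻ σ in Set.Ioo x z, J σ := by gcongr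
    _ ≤ _ := by rw [add_assoc]; gcongr

/-- A function satisfying `h ≥ A + ∫ h ^ (α + 1)` can stay finite only up to the blow-up time of the
corresponding ordinary differential equation. -/
lemma mul_le_rpow_neg_of_rpow_le {α t : ℝ} (hα : 0 < α) (ht : 0 < t) {A : ℝ≥0∞} (hA : A ≠ 0)
    {J : ℝ → ℝ≥0∞} (hJ : Measurable J) (hfin : A + ∫⁻ σ in Set.Ioo 0 t, J σ ≠ ∞)
    (hineq : ∀ s ∈ Set.Ioo 0 t, (A + ∫⁻ σ in Set.Ioo 0 s, J σ) ^ (α + 1) ≤ J s) :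
    α * t ≤ A.toReal ^ (-α) := by
  set L : ℝ → ℝ≥0∞ := fun s => A + ∫⁻ σ in Set.Ioo 0 s, J σ with hL
  have hLfin : ∀ s ≤ t, L s ≠ ∞ := fun s hs => ne_top_of_le_ne_top hfin <| by
    simp only [hL]; gcongr
  have hLpos : ∀ s ≤ t, 0 < (L s).toReal := fun s hs =>
    ENNReal.toReal_pos (by simp [hL, hA]) (hLfin s hs)
  have hstep : ∀ x z, 0 ≤ x → x ≤ z → z ≤ t →
      (L x).toReal + (z - x) * (L x).toReal ^ (α + 1) ≤ (L z).toReal := by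
    intro x z hx hxz hz
    have h := lintegral_Ioo_add_le_of_rpow_le (by linarith) hineq hx hxz hz
    have hpow : L x ^ (α + 1) ≠ ∞ :=
      ENNReal.rpow_ne_top_of_nonneg (by linarith) (hLfin x (hxz.trans hz))
    have h' := ENNReal.toReal_mono (hLfin z hz) h
    rwa [ENNReal.toReal_add (hLfin x (hxz.trans hz)) (ENNReal.mul_ne_top ENNReal.ofReal_ne_top hpow),
      ENNReal.toReal_mul, ENNReal.toReal_ofReal (by linarith), ← ENNReal.toReal_rpow] at h'
  have hAfin : A ≠ ∞ := ne_top_of_le_ne_top hfin le_self_add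
  have hint : ∀ s ≤ t, ∫⁻ σ in Set.Ioo 0 s, J σ ≠ ∞ := fun s hs =>
    ne_top_of_le_ne_top (hLfin s hs) le_add_self
  have hcont : ContinuousOn (fun s => (L s).toReal) (Set.Icc 0 t) := by
    have hi : IntegrableOn (fun σ => (J σ).toReal) (Set.Icc 0 t) := by
      rw [integrableOn_Icc_iff_integrableOn_Ioo]
      exact integrable_toReal_of_lintegral_ne_top hJ.aemeasurable (hint t le_rfl)
    have hc := (continuousOn_const (c := A.toReal)).add (intervalIntegral.continuousOn_primitive hi)
    refine hc.congr fun s hs => ?_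
    simp only [hL, Pi.add_apply]
    rw [ENNReal.toReal_add hAfin (hint s hs.2), integral_Ioc_eq_integral_Ioo,
      integral_toReal hJ.aemeasurable (ae_lt_top hJ (hint s hs.2))]
  have key := image_le_of_liminf_slope_right_le_deriv_boundary (a := 0) (b := t)
    (f := fun s => (L s).toReal ^ (-α)) (B := fun s => A.toReal ^ (-α) - α * s)
    (B' := fun _ => -α) (hcont.rpow_const fun s hs => Or.inl (hLpos s hs.2).ne')
    (by simp [hL]) (by fun_prop)
    (fun s _ => by
      simpa using (((hasDerivAt_id s).const_mul α).const_sub (A.toReal ^ (-α))).hasDerivWithinAt)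
    (fun x hx r hr => by
      have hxpos := hLpos x hx.2.le
      have hd : HasDerivAt (fun z => ((L x).toReal + (z - x) * (L x).toReal ^ (α + 1)) ^ (-α))
          (-α) x := by
        have h1 : HasDerivAt (fun z => (L x).toReal + (z - x) * (L x).toReal ^ (α + 1))
            ((L x).toReal ^ (α + 1)) x := by
          simpa using (((hasDerivAt_id x).sub_const x).mul_const
            ((L x).toReal ^ (α + 1))).const_add (L x).toReal
        have h2 := h1.rpow_const (p := -α) (Or.inl (by simpa using hxpos.ne'))
        convert h2 using 1
        simp only [sub_self, zero_mul, add_zero]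
        rw [mul_right_comm, ← Real.rpow_add hxpos]
        simp
      have hs := (hasDerivAt_iff_tendsto_slope.1 hd).mono_left
        (nhdsWithin_mono x (fun z (hz : x < z) => hz.ne'))
      refine Eventually.frequently ?_
      filter_upwards [hs.eventually_lt_const hr, Ioo_mem_nhdsGT hx.2] with z hz hzx
      refine lt_of_le_of_lt ?_ hz
      simp only [slope_def_field, sub_self, zero_mul, add_zero]
      have hzx' : 0 < z - x := sub_pos.2 hzx.1
      gcongr ?_ / _
      refine sub_le_sub_right ?_ _
      exact Real.rpow_le_rpow_of_nonpos (by positivity) (hstep x z hx.1 hzx.1.le hzx.2.le)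
        (by linarith))
  have h := key (Set.right_mem_Icc.2 ht.le)
  have : 0 < (L t).toReal ^ (-α) := Real.rpow_pos_of_pos (hLpos t le_rfl) _
  linarith

lemma measurable_heatKernel_sub (N : ℕ) (t : ℝ) :
    Measurable fun q : ℝ × ESp N × ESp N =>
      ENNReal.ofReal (heatKernel N (t - q.1) (q.2.1 - q.2.2)) :=
  ((measurable_heatKernel N).comp (f := fun q : ℝ × ESp N × ESp N => (t - q.1, q.2.1 - q.2.2))
    (by fun_prop)).ennreal_ofReal

lemma measurable_heatKernel_diff (N : ℕ) (t : ℝ) :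
    Measurable fun q : ESp N × ESp N => ENNReal.ofReal (heatKernel N t (q.1 - q.2)) :=
  ((measurable_heatKernel N).comp (f := fun q : ESp N × ESp N => (t, q.1 - q.2))
    (by fun_prop)).ennreal_ofReal

lemma measurable_heatKernel_right (N : ℕ) (t : ℝ) (x : ESp N) :
    Measurable fun y : ESp N => ENNReal.ofReal (heatKernel N t (x - y)) :=
  (measurable_heatKernel_diff N t).comp (f := fun y => (x, y)) (by fun_prop)

/-- Applying the heat semigroup to a mild solution at time `s` gives the Duhamel formula with the
time integral cut off at `s`. -/
lemma lintegral_heatKernel_mul_mildSolution {N : ℕ} {α T : ℝ} {μ₀ : Measure (ESp N)}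
    [SFinite μ₀] {u : ℝ → ESp N → ℝ≥0∞} (hu : IsNonnegMildSolutionMeas N α T μ₀ u)
    {s t : ℝ} (hs : 0 < s) (hst : s < t) (htT : t < T) (x : ESp N) :
    ∫⁻ y, ENNReal.ofReal (heatKernel N (t - s) (x - y)) * u s y =
      (∫⁻ y, ENNReal.ofReal (heatKernel N t (x - y)) ∂μ₀) +
        ∫⁻ σ in Set.Ioo (0 : ℝ) s,
          ∫⁻ y, ENNReal.ofReal (heatKernel N (t - σ) (x - y)) * u σ y ^ (α + 1) := by
  have hu1 : Measurable fun q : ℝ × ESp N => u q.1 q.2 ^ (α + 1) := hu.1.pow_const _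
  have hts : 0 < t - s := sub_pos.2 hst
  have hg : Measurable fun y => ENNReal.ofReal (heatKernel N (t - s) (x - y)) :=
    measurable_heatKernel_right N (t - s) x
  have hF : Measurable fun q : ℝ × ESp N × ESp N =>
      ENNReal.ofReal (heatKernel N (s - q.1) (q.2.1 - q.2.2)) * u q.1 q.2.2 ^ (α + 1) :=
    (measurable_heatKernel_sub N s).mul
      (hu1.comp (f := fun q : ℝ × ESp N × ESp N => (q.1, q.2.2)) (by fun_prop))
  have hF1 : Measurable fun q : ℝ × ESp N =>
      ∫⁻ z, ENNReal.ofReal (heatKernel N (s - q.1) (q.2 - z)) * u q.1 z ^ (α + 1) :=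
    Measurable.lintegral_prod_right' (ν := volume)
      (hF.comp (f := fun q : (ℝ × ESp N) × ESp N => (q.1.1, q.1.2, q.2)) (by fun_prop))
  calc ∫⁻ y, ENNReal.ofReal (heatKernel N (t - s) (x - y)) * u s y
      = ∫⁻ y, ((ENNReal.ofReal (heatKernel N (t - s) (x - y)) *
            ∫⁻ z, ENNReal.ofReal (heatKernel N s (y - z)) ∂μ₀) +
          ENNReal.ofReal (heatKernel N (t - s) (x - y)) * ∫⁻ σ in Set.Ioo (0 : ℝ) s,
            ∫⁻ z, ENNReal.ofReal (heatKernel N (s - σ) (y - z)) * u σ z ^ (α + 1)) := by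
        refine lintegral_congr_ae ?_
        filter_upwards [(hu.2 s ⟨hs, hst.trans htT⟩).2] with y hy
        rw [hy, mul_add]
    _ = (∫⁻ y, ENNReal.ofReal (heatKernel N (t - s) (x - y)) *
            ∫⁻ z, ENNReal.ofReal (heatKernel N s (y - z)) ∂μ₀) +
          ∫⁻ y, ENNReal.ofReal (heatKernel N (t - s) (x - y)) * ∫⁻ σ in Set.Ioo (0 : ℝ) s,
            ∫⁻ z, ENNReal.ofReal (heatKernel N (s - σ) (y - z)) * u σ z ^ (α + 1) :=
        lintegral_add_left (hg.mul (measurable_heatKernel_diff N s).lintegral_prod_right') _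
    _ = _ := by
        congr 1
        · calc _ = ∫⁻ y, ∫⁻ z, ENNReal.ofReal (heatKernel N (t - s) (x - y)) *
                ENNReal.ofReal (heatKernel N s (y - z)) ∂μ₀ :=
                lintegral_congr fun y => (lintegral_const_mul _
                  (measurable_heatKernel_right N s y)).symm
            _ = ∫⁻ z, (∫⁻ y, ENNReal.ofReal (heatKernel N (t - s) (x - y)) *
                ENNReal.ofReal (heatKernel N s (y - z))) ∂μ₀ :=
                lintegral_lintegral_swap
                  ((hg.comp measurable_fst).mul (measurable_heatKernel_diff N s)).aemeasurable
            _ = _ := by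
                refine lintegral_congr fun z => ?_
                rw [lintegral_heatKernel_mul_heatKernel N hts hs, sub_add_cancel]
        · calc _ = ∫⁻ y, ∫⁻ σ in Set.Ioo (0 : ℝ) s,
                ENNReal.ofReal (heatKernel N (t - s) (x - y)) *
                ∫⁻ z, ENNReal.ofReal (heatKernel N (s - σ) (y - z)) * u σ z ^ (α + 1) :=
                lintegral_congr fun y => (lintegral_const_mul _
                  (hF1.comp (f := fun σ : ℝ => (σ, y)) (by fun_prop))).symm
            _ = ∫⁻ σ in Set.Ioo (0 : ℝ) s, ∫⁻ y,
                ENNReal.ofReal (heatKernel N (t - s) (x - y)) *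
                ∫⁻ z, ENNReal.ofReal (heatKernel N (s - σ) (y - z)) * u σ z ^ (α + 1) :=
                lintegral_lintegral_swap
                  ((hg.comp measurable_fst).mul (hF1.comp measurable_swap)).aemeasurable
            _ = _ := by
                refine setLIntegral_congr_fun measurableSet_Ioo fun σ hσ => ?_
                have hsσ : 0 < s - σ := sub_pos.2 hσ.2
                calc _ = ∫⁻ y, ∫⁻ z, ENNReal.ofReal (heatKernel N (t - s) (x - y)) *
                      (ENNReal.ofReal (heatKernel N (s - σ) (y - z)) * u σ z ^ (α + 1)) :=
                      lintegral_congr fun y => (lintegral_const_mul _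
                        (hF.comp (f := fun z => (σ, y, z)) (by fun_prop))).symm
                  _ = ∫⁻ z, ∫⁻ y, ENNReal.ofReal (heatKernel N (t - s) (x - y)) *
                      (ENNReal.ofReal (heatKernel N (s - σ) (y - z)) * u σ z ^ (α + 1)) :=
                      lintegral_lintegral_swap ((hg.comp measurable_fst).mul
                        (hF.comp (f := fun q : ESp N × ESp N => (σ, q))
                          (by fun_prop))).aemeasurable
                  _ = _ := by
                      refine lintegral_congr fun z => ?_
                      have hm : Measurable fun y => ENNReal.ofReal (heatKernel N (t - s) (x - y)) *
                          ENNReal.ofReal (heatKernel N (s - σ) (y - z)) :=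
                        hg.mul ((measurable_heatKernel_diff N (s - σ)).comp
                          (f := fun y => (y, z)) (by fun_prop))
                      simp_rw [← mul_assoc]
                      rw [lintegral_mul_const _ hm,
                        lintegral_heatKernel_mul_heatKernel N hts hsσ, sub_add_sub_cancel]

lemma ae_mul_le_lintegral_heatKernel_rpow {N : ℕ} {α T : ℝ} (hα : 0 < α) {μ₀ : Measure (ESp N)}
    [SFinite μ₀] {u : ℝ → ESp N → ℝ≥0∞} (hu : IsNonnegMildSolutionMeas N α T μ₀ u)
    {t : ℝ} (ht : t ∈ Set.Ioo 0 T) : ∀ᵐ x : ESp N ∂volume,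
    (∫⁻ y, ENNReal.ofReal (heatKernel N t (x - y)) ∂μ₀) ≠ ∞ ∧
    ((∫⁻ y, ENNReal.ofReal (heatKernel N t (x - y)) ∂μ₀) ≠ 0 →
      α * t ≤ (∫⁻ y, ENNReal.ofReal (heatKernel N t (x - y)) ∂μ₀).toReal ^ (-α)) := by
  filter_upwards [(hu.2 t ht).1, (hu.2 t ht).2] with x hfin hx
  rw [hx] at hfin
  refine ⟨ne_top_of_le_ne_top hfin.ne le_self_add, fun hA => ?_⟩
  have hu1 : Measurable fun q : ℝ × ESp N => u q.1 q.2 ^ (α + 1) := hu.1.pow_const _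
  refine mul_le_rpow_neg_of_rpow_le hα ht.1 hA ?_ hfin.ne fun s hs => ?_
  · exact Measurable.lintegral_prod_right' (ν := volume)
      (f := fun q : ℝ × ESp N =>
        ENNReal.ofReal (heatKernel N (t - q.1) (x - q.2)) * u q.1 q.2 ^ (α + 1))
      (((measurable_heatKernel_sub N t).comp (f := fun q : ℝ × ESp N => (q.1, x, q.2))
        (by fun_prop)).mul hu1)
  · rw [← lintegral_heatKernel_mul_mildSolution hu hs.1 hs.2 ht.2 x]
    exact rpow_lintegral_mul_le volume (measurable_heatKernel_right N (t - s) x)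
      (hu.1.of_uncurry_left (x := s)) (lintegral_heatKernel_s11 N (sub_pos.2 hs.2) x) (by linarith)

/-- The mass of `𝔪` weighted by a Gaussian that bounds, up to normalization, the heat kernel at
time `t` from below uniformly over centres in the unit ball. -/
def gaussianMass {N : ℕ} (𝔪 : Measure (ESp N)) (t : ℝ) : ℝ :=
  ∫ y, Real.exp (-(1 + ‖y‖) ^ 2 / (4 * t)) ∂𝔪

lemma integrable_exp_neg_sq_div {N : ℕ} (𝔪 : Measure (ESp N)) [IsFiniteMeasure 𝔪] {t : ℝ}
    (ht : 0 < t) : Integrable (fun y : ESp N => Real.exp (-(1 + ‖y‖) ^ 2 / (4 * t))) 𝔪 := by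
  refine Integrable.of_bound (by fun_prop) 1 (ae_of_all _ fun y => ?_)
  rw [Real.norm_eq_abs, Real.abs_exp, Real.exp_le_one_iff]
  exact div_nonpos_of_nonpos_of_nonneg (by simp [sq_nonneg]) (by positivity)

lemma gaussianMass_pos {N : ℕ} (𝔪 : Measure (ESp N)) [IsFiniteMeasure 𝔪] (h𝔪 : 𝔪 ≠ 0) {t : ℝ}
    (ht : 0 < t) : 0 < gaussianMass 𝔪 t := by
  have : NeZero 𝔪 := ⟨h𝔪⟩
  exact integral_exp_pos (integrable_exp_neg_sq_div 𝔪 ht)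

lemma gaussianMass_mono {N : ℕ} (𝔪 : Measure (ESp N)) [IsFiniteMeasure 𝔪] {s t : ℝ}
    (hs : 0 < s) (hst : s ≤ t) : gaussianMass 𝔪 s ≤ gaussianMass 𝔪 t := by
  refine integral_mono (integrable_exp_neg_sq_div 𝔪 hs)
    (integrable_exp_neg_sq_div 𝔪 (hs.trans_le hst)) fun y => ?_
  simp only [neg_div]
  gcongr

lemma tendsto_gaussianMass {N : ℕ} (𝔪 : Measure (ESp N)) [IsFiniteMeasure 𝔪] :
    Tendsto (gaussianMass 𝔪) atTop (nhds (𝔪 Set.univ).toReal) := by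
  have h : (𝔪 Set.univ).toReal = ∫ _ : ESp N, (1 : ℝ) ∂𝔪 := by simp [Measure.real]
  rw [h]
  refine tendsto_integral_filter_of_dominated_convergence (fun _ => 1)
    (Eventually.of_forall fun t => by fun_prop) ?_ (integrable_const _) (ae_of_all _ fun y => ?_)
  · filter_upwards [eventually_gt_atTop 0] with t ht
    refine ae_of_all _ fun y => ?_
    rw [Real.norm_eq_abs, Real.abs_exp, Real.exp_le_one_iff]
    exact div_nonpos_of_nonpos_of_nonneg (by simp [sq_nonneg]) (by positivity)
  · have h4 : Tendsto (fun t : ℝ => 4 * t) atTop atTop :=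
      tendsto_id.const_mul_atTop (by norm_num)
    simpa [Function.comp_def] using (Real.continuous_exp.tendsto 0).comp
      (h4.const_div_atTop (-(1 + ‖y‖) ^ 2))

lemma ofReal_mul_gaussianMass_le {N : ℕ} (𝔪 : Measure (ESp N)) [IsFiniteMeasure 𝔪] {lam t : ℝ}
    (hlam : 0 < lam) (ht : 0 < t) {x : ESp N} (hx : ‖x‖ ≤ 1) :
    ENNReal.ofReal (lam * ((4 * π * t) ^ (-(N : ℝ) / 2) * gaussianMass 𝔪 t)) ≤
      ∫⁻ y, ENNReal.ofReal (heatKernel N t (x - y)) ∂(ENNReal.ofReal lam • 𝔪) := by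
  rw [lintegral_smul_measure, smul_eq_mul, ENNReal.ofReal_mul hlam.le]
  gcongr
  rw [gaussianMass, ← integral_const_mul, ofReal_integral_eq_lintegral_ofReal
    ((integrable_exp_neg_sq_div 𝔪 ht).const_mul _) (ae_of_all _ fun y => by positivity)]
  refine lintegral_mono fun y => ENNReal.ofReal_le_ofReal ?_
  unfold heatKernel
  have : ‖x - y‖ ≤ 1 + ‖y‖ := (norm_sub_le x y).trans (by gcongr)
  simp only [neg_div]
  gcongr

lemma rpow_mul_le_of_isNonnegMildSolutionMeas {N : ℕ} {α : ℝ} (hα : 0 < α)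
    (hk : 0 < α⁻¹ - (N : ℝ) / 2) (𝔪 : Measure (ESp N)) [IsFiniteMeasure 𝔪] (h𝔪 : 𝔪 ≠ 0)
    {lam T : ℝ} (hlam : 0 < lam) {u : ℝ → ESp N → ℝ≥0∞}
    (hu : IsNonnegMildSolutionMeas N α T (ENNReal.ofReal lam • 𝔪) u) {t : ℝ}
    (ht : t ∈ Set.Ioo 0 T) :
    lam ^ (α⁻¹ - (N : ℝ) / 2)⁻¹ * t ≤
      (α ^ α⁻¹ * (4 * π) ^ (-(N : ℝ) / 2) * gaussianMass 𝔪 t) ^ (-(α⁻¹ - (N : ℝ) / 2)⁻¹) := by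
  have ht0 : 0 < t := ht.1
  have hF := gaussianMass_pos 𝔪 h𝔪 ht0
  set F := gaussianMass 𝔪 t with hFdef
  set k := α⁻¹ - (N : ℝ) / 2 with hkdef
  set B := lam * ((4 * π * t) ^ (-(N : ℝ) / 2) * F) with hB
  have hBpos : 0 < B := by positivity
  have hfin : IsFiniteMeasure (ENNReal.ofReal lam • 𝔪) :=
    𝔪.smul_finite ENNReal.ofReal_ne_top
  have hαt : α * t ≤ B ^ (-α) := by
    obtain ⟨x, hx, hfin, hbound⟩ :=
      (Measure.dense_of_ae (ae_mul_le_lintegral_heatKernel_rpow hα hu ht)).inter_open_nonempty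
        (Metric.ball 0 1) Metric.isOpen_ball (Metric.nonempty_ball.2 one_pos)
    have hle := ofReal_mul_gaussianMass_le 𝔪 hlam ht0 (mem_ball_zero_iff.1 hx).le
    have hA := ((ENNReal.ofReal_pos.2 hBpos).trans_le hle).ne'
    exact (hbound hA).trans (Real.rpow_le_rpow_of_nonpos hBpos
      ((ENNReal.ofReal_le_iff_le_toReal hfin).1 hle) (by linarith))
  have h1 : (α * t) ^ α⁻¹ ≤ B⁻¹ := by
    calc (α * t) ^ α⁻¹ ≤ (B ^ (-α)) ^ α⁻¹ := by gcongr
      _ = B⁻¹ := by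
        rw [← Real.rpow_mul hBpos.le, neg_mul, mul_inv_cancel₀ hα.ne', Real.rpow_neg_one]
  set D := α ^ α⁻¹ * (4 * π) ^ (-(N : ℝ) / 2) * F with hD
  have hDpos : 0 < D := by positivity
  have h2 : lam * t ^ k ≤ D⁻¹ := by
    have e : (α * t) ^ α⁻¹ * B = D * (lam * t ^ k) := by
      have hk' : k = α⁻¹ + -(N : ℝ) / 2 := by rw [hkdef]; ring
      rw [hB, hD, hk', Real.rpow_add ht0, Real.mul_rpow hα.le ht0.le,
        Real.mul_rpow (by positivity) ht0.le]
      ring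
    rw [← one_div B, le_div_iff₀ hBpos, e] at h1
    rwa [← one_div D, le_div_iff₀' hDpos]
  calc lam ^ k⁻¹ * t = (lam * t ^ k) ^ k⁻¹ := by
        rw [Real.mul_rpow hlam.le (by positivity), Real.rpow_rpow_inv ht0.le hk.ne']
    _ ≤ (D⁻¹) ^ k⁻¹ := by gcongr
    _ = D ^ (-k⁻¹) := by rw [Real.inv_rpow hDpos.le, Real.rpow_neg hDpos.le]

lemma rpow_mul_le_of_isNonnegMildSolutionMeas_of_lt {N : ℕ} {α : ℝ} (hα : 0 < α)
    (hk : 0 < α⁻¹ - (N : ℝ) / 2) (𝔪 : Measure (ESp N)) [IsFiniteMeasure 𝔪] (h𝔪 : 𝔪 ≠ 0)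
    {lam T : ℝ} (hlam : 0 < lam) {u : ℝ → ESp N → ℝ≥0∞}
    (hu : IsNonnegMildSolutionMeas N α T (ENNReal.ofReal lam • 𝔪) u) {t₀ : ℝ}
    (ht₀ : 0 < t₀) (htT : t₀ < T) :
    lam ^ (α⁻¹ - (N : ℝ) / 2)⁻¹ * T ≤
      (α ^ α⁻¹ * (4 * π) ^ (-(N : ℝ) / 2) * gaussianMass 𝔪 t₀) ^ (-(α⁻¹ - (N : ℝ) / 2)⁻¹) := by
  have hF := gaussianMass_pos 𝔪 h𝔪 ht₀
  have hlk : 0 < lam ^ (α⁻¹ - (N : ℝ) / 2)⁻¹ := by positivity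
  rw [← le_div_iff₀' hlk]
  refine le_of_forall_lt_imp_le_of_dense fun s hs => ?_
  rw [le_div_iff₀' hlk]
  have hm : max s t₀ ∈ Set.Ioo 0 T := ⟨lt_max_of_lt_right ht₀, max_lt hs htT⟩
  calc _ ≤ lam ^ (α⁻¹ - (N : ℝ) / 2)⁻¹ * max s t₀ := by gcongr; exact le_max_left _ _
    _ ≤ _ := rpow_mul_le_of_isNonnegMildSolutionMeas hα hk 𝔪 h𝔪 hlam hu hm
    _ ≤ _ := by
      refine Real.rpow_le_rpow_of_nonpos (by positivity) ?_ (by simpa using hk.le)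
      gcongr
      exact gaussianMass_mono 𝔪 ht₀ (le_max_right _ _)

/-- Upper bound for the life-span, as `λ → 0`, of nonnegative solutions with
initial datum a positive finite Borel measure `λ𝔪`, when `0 < α < 2/N`:
(i) the life-span is always finite, and (ii)
`limsup_{λ→0} λ^{(1/α - N/2)⁻¹} T_max(λ𝔪) ≤ (α^{1/α}(4π)^{-N/2} 𝔪(ℝ^N))^{-(1/α - N/2)⁻¹}`. -/
theorem stmt11 (N : ℕ) (hN : 1 ≤ N) (α : ℝ) (hα : 0 < α) (hαN : α < 2 / N)
    (𝔪 : Measure (ESp N)) [IsFiniteMeasure 𝔪] (h𝔪 : 𝔪 ≠ 0) :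
    (∀ lam : ℝ, 0 < lam →
      BddAbove {T : ℝ | 0 < T ∧ ∃ u : ℝ → ESp N → ℝ≥0∞,
        IsNonnegMildSolutionMeas N α T (ENNReal.ofReal lam • 𝔪) u}) ∧
    (∀ δ : ℝ, 0 < δ → ∃ lam₀ : ℝ, 0 < lam₀ ∧
      ∀ lam : ℝ, 0 < lam → lam ≤ lam₀ →
        ∀ T : ℝ, 0 < T →
          (∃ u : ℝ → ESp N → ℝ≥0∞,
            IsNonnegMildSolutionMeas N α T (ENNReal.ofReal lam • 𝔪) u) →
          lam ^ (α⁻¹ - (N : ℝ) / 2)⁻¹ * T ≤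
            (α ^ α⁻¹ * (4 * π) ^ (-(N : ℝ) / 2) * (𝔪 Set.univ).toReal) ^
              (-(α⁻¹ - (N : ℝ) / 2)⁻¹) + δ) := by
  have hN' : (0 : ℝ) < N := by exact_mod_cast hN
  have hk : 0 < α⁻¹ - (N : ℝ) / 2 := by
    rw [sub_pos, ← inv_div]
    gcongr
  constructor
  · intro lam hlam
    refine ⟨max 1 ((α ^ α⁻¹ * (4 * π) ^ (-(N : ℝ) / 2) * gaussianMass 𝔪 1) ^
      (-(α⁻¹ - (N : ℝ) / 2)⁻¹) / lam ^ (α⁻¹ - (N : ℝ) / 2)⁻¹), ?_⟩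
    rintro T ⟨hT, u, hu⟩
    rcases le_or_gt T 1 with h | h
    · exact le_max_of_le_left h
    · refine le_max_of_le_right ?_
      rw [le_div_iff₀' (by positivity)]
      exact rpow_mul_le_of_isNonnegMildSolutionMeas_of_lt hα hk 𝔪 h𝔪 hlam hu one_pos h
  · intro δ hδ
    have hM : 0 < (𝔪 Set.univ).toReal :=
      ENNReal.toReal_pos (by simpa using h𝔪) (measure_ne_top _ _)
    have hlim := ((tendsto_gaussianMass 𝔪).const_mul
      (α ^ α⁻¹ * (4 * π) ^ (-(N : ℝ) / 2))).rpow_const (p := -(α⁻¹ - (N : ℝ) / 2)⁻¹)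
      (Or.inl (by positivity))
    obtain ⟨t₀, hlt, ht₀⟩ :=
      ((hlim.eventually_lt_const (lt_add_of_pos_right _ hδ)).and (eventually_gt_atTop 0)).exists
    refine ⟨(δ / t₀) ^ (α⁻¹ - (N : ℝ) / 2), by positivity, ?_⟩
    rintro lam hlam hle T hT ⟨u, hu⟩
    rcases le_or_gt T t₀ with h | h
    · calc lam ^ (α⁻¹ - (N : ℝ) / 2)⁻¹ * T
          ≤ ((δ / t₀) ^ (α⁻¹ - (N : ℝ) / 2)) ^ (α⁻¹ - (N : ℝ) / 2)⁻¹ * t₀ := by gcongr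
        _ = δ := by
          rw [Real.rpow_rpow_inv (by positivity) hk.ne', div_mul_cancel₀ _ ht₀.ne']
        _ ≤ _ := le_add_of_nonneg_left (by positivity)
    · exact (rpow_mul_le_of_isNonnegMildSolutionMeas_of_lt hα hk 𝔪 h𝔪 hlam hu ht₀ h).trans hlt.le
end
end
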